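/- Assume that for every degree m ≤ n, every GC_m set possesses a maximal line (the GM conjecture up to degree n). Let X be a GC_n set and let ℓ be a k-node line of X with 2 ≤ k ≤ n+1. If 2k − n − 1 ≥ 3 and μ(X) > 3, then X_ℓ ≠ ∅, i.e., the line ℓ is used by at least one node of X. -/

import Mathlib

open MvPolynomial

/-- Bivariate real polynomials. -/
abbrev Poly2 : Type := MvPolynomial (Fin 2) ℝ

/-- Evaluation of a bivariate polynomial at a point of `ℝ²`. -/
noncomputable def evalPt (p : Poly2) (A : ℝ × ℝ) : ℝ :=
  MvPolynomial.eval (fun i => if i = 0 then A.1 else A.2) p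

/-- `X` is an `n`-poised set: it has `(n+2 choose 2)` nodes and the only polynomial of
total degree at most `n` vanishing on all of `X` is the zero polynomial. -/
def IsPoised (n : ℕ) (X : Finset (ℝ × ℝ)) : Prop :=
  X.card = (n + 2).choose 2 ∧
    ∀ p : Poly2, p.totalDegree ≤ n → (∀ A ∈ X, evalPt p A = 0) → p = 0

/-- `p` is an `n`-fundamental polynomial of the node `A` with respect to `X`. -/
def IsFund (n : ℕ) (X : Finset (ℝ × ℝ)) (A : ℝ × ℝ) (p : Poly2) : Prop :=
  p.totalDegree ≤ n ∧ evalPt p A = 1 ∧ ∀ B ∈ X, B ≠ A → evalPt p B = 0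

/-- `X` is a `GC_n` set: `n`-poised and each node has a fundamental polynomial which is
a product of `n` polynomials of degree 1. -/
def IsGC (n : ℕ) (X : Finset (ℝ × ℝ)) : Prop :=
  IsPoised n X ∧
    ∀ A ∈ X, ∃ p : Poly2, IsFund n X A p ∧
      ∃ f : Fin n → Poly2, (∀ i, (f i).totalDegree = 1) ∧ p = ∏ i, f i

/-- The nodes of `X` lying on the zero set of `ℓ`. -/
noncomputable def nodesOn (X : Finset (ℝ × ℝ)) (ℓ : Poly2) : Finset (ℝ × ℝ) :=
  @Finset.filter _ (fun A => evalPt ℓ A = 0) (Classical.decPred _) X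

/-- `ℓ` is a `k`-node line of `X`: it has degree exactly 1 and passes through exactly
`k` nodes of `X`. -/
def IsKNodeLine (X : Finset (ℝ × ℝ)) (ℓ : Poly2) (k : ℕ) : Prop :=
  ℓ.totalDegree = 1 ∧ (nodesOn X ℓ).card = k

/-- A maximal line of an `n`-poised set: an `(n+1)`-node line. -/
def IsMaximalLine (n : ℕ) (X : Finset (ℝ × ℝ)) (ℓ : Poly2) : Prop :=
  IsKNodeLine X ℓ (n + 1)

/-- The zero set of a polynomial, i.e. the line it determines when it has degree 1. -/
def zeroSet (ℓ : Poly2) : Set (ℝ × ℝ) := {A | evalPt ℓ A = 0}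

/-- `μ(X)`: the number of maximal lines (as subsets of the plane) of `X`. -/
noncomputable def mu (n : ℕ) (X : Finset (ℝ × ℝ)) : ℕ :=
  {L : Set (ℝ × ℝ) | ∃ ℓ : Poly2, IsMaximalLine n X ℓ ∧ L = zeroSet ℓ}.ncard

/-- The node `A` of `X` uses the line `ℓ`: `ℓ` divides a fundamental polynomial of `A`. -/
def Uses (n : ℕ) (X : Finset (ℝ × ℝ)) (ℓ : Poly2) (A : ℝ × ℝ) : Prop :=
  ∃ p : Poly2, IsFund n X A p ∧ ℓ ∣ p

/-- `X_ℓ`: the set of nodes of `X` using the line `ℓ`. -/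
noncomputable def usesSet (n : ℕ) (X : Finset (ℝ × ℝ)) (ℓ : Poly2) : Finset (ℝ × ℝ) :=
  @Finset.filter _ (Uses n X ℓ) (Classical.decPred _) X

/-- The Gasca–Maeztu conjecture for degree `m`: every `GC_m` set has a maximal line. -/
def GM (m : ℕ) : Prop :=
  ∀ Y : Finset (ℝ × ℝ), IsGC m Y → ∃ lam : Poly2, IsMaximalLine m Y lam


open MvPolynomial

set_option linter.unusedSimpArgs false
set_option linter.unusedVariables false

/-! ### Algebra of linear polynomials -/

lemma evalPt_mul (p q : Poly2) (A : ℝ × ℝ) : evalPt (p * q) A = evalPt p A * evalPt q A := by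
  simp [evalPt]

lemma evalPt_sub (p q : Poly2) (A : ℝ × ℝ) : evalPt (p - q) A = evalPt p A - evalPt q A := by
  simp [evalPt]

lemma evalPt_C (c : ℝ) (A : ℝ × ℝ) : evalPt (C c) A = c := by
  simp [evalPt]

lemma evalPt_prod {ι : Type*} (s : Finset ι) (f : ι → Poly2) (A : ℝ × ℝ) :
    evalPt (∏ i ∈ s, f i) A = ∏ i ∈ s, evalPt (f i) A := by
  simp [evalPt, map_prod]

lemma deg1_form (l : Poly2) (h : l.totalDegree = 1) :
    ∃ a b c : ℝ, (a ≠ 0 ∨ b ≠ 0) ∧ l = C a * X 0 + C b * X 1 + C c := by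
  have key : l = C (coeff (Finsupp.single 0 1) l) * X 0 + C (coeff (Finsupp.single 1 1) l) * X 1
      + C (coeff 0 l) := by
    ext m
    by_cases hm : 2 ≤ m 0 + m 1
    · rw [coeff_eq_zero_of_totalDegree_lt]
      · have h0 : m ≠ 0 := by rintro rfl; simp at hm
        have h1 : Finsupp.single 0 1 ≠ m := by
          rintro rfl
          simp [Finsupp.single_apply] at hm
        have h2 : Finsupp.single 1 1 ≠ m := by
          rintro rfl
          simp [Finsupp.single_apply] at hm
        simp [coeff_C_mul, coeff_X, coeff_C, h1, h2, h0.symm]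
      · rw [h, ← Finsupp.degree_apply, Finsupp.degree_eq_sum]
        simp only [Fin.sum_univ_two]
        omega
    · have : m = 0 ∨ m = Finsupp.single 0 1 ∨ m = Finsupp.single 1 1 := by
        have h3 : (m 0 = 0 ∧ m 1 = 0) ∨ (m 0 = 1 ∧ m 1 = 0) ∨ (m 0 = 0 ∧ m 1 = 1) := by omega
        rcases h3 with h3 | h3 | h3
        · left; ext i; fin_cases i <;> simp [h3]
        · right; left; ext i; fin_cases i <;> simp [h3, Finsupp.single_apply]
        · right; right; ext i; fin_cases i <;> simp [h3, Finsupp.single_apply]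
      rcases this with rfl | rfl | rfl
      · simp [coeff_C_mul, coeff_X, coeff_C]
      · have e1 : (Finsupp.single (1 : Fin 2) 1 : Fin 2 →₀ ℕ) ≠ Finsupp.single 0 1 := by
          intro h; have := DFunLike.congr_fun h 0; simp [Finsupp.single_apply] at this
        have e2 : (0 : Fin 2 →₀ ℕ) ≠ Finsupp.single 0 1 := by
          intro h; have := DFunLike.congr_fun h 0; simp [Finsupp.single_apply] at this
        simp [coeff_C_mul, coeff_X, coeff_C, e1, e2]
      · have e1 : (Finsupp.single (0 : Fin 2) 1 : Fin 2 →₀ ℕ) ≠ Finsupp.single 1 1 := by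
          intro h; have := DFunLike.congr_fun h 0; simp [Finsupp.single_apply] at this
        have e2 : (0 : Fin 2 →₀ ℕ) ≠ Finsupp.single 1 1 := by
          intro h; have := DFunLike.congr_fun h 1; simp [Finsupp.single_apply] at this
        simp [coeff_C_mul, coeff_X, coeff_C, e1, e2]
  refine ⟨_, _, _, ?_, key⟩
  by_contra hcon
  push Not at hcon
  rw [hcon.1, hcon.2] at key
  rw [key] at h
  simp at h

lemma evalPt_form (a b c : ℝ) (A : ℝ × ℝ) :
    evalPt (C a * X 0 + C b * X 1 + C c) A = a * A.1 + b * A.2 + c := by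
  simp [evalPt]

/-- A line, as a subset of the plane. -/
def IsLine (L : Set (ℝ × ℝ)) : Prop := ∃ l : Poly2, l.totalDegree = 1 ∧ zeroSet l = L

lemma mem_zeroSet (l : Poly2) (A : ℝ × ℝ) : A ∈ zeroSet l ↔ evalPt l A = 0 := Iff.rfl

lemma deg1_unique (l l' : Poly2) (h : l.totalDegree = 1) (h' : l'.totalDegree = 1)
    (A B : ℝ × ℝ) (hAB : A ≠ B) (h1 : evalPt l A = 0) (h2 : evalPt l B = 0)
    (h3 : evalPt l' A = 0) (h4 : evalPt l' B = 0) : ∃ k : ℝ, k ≠ 0 ∧ l' = C k * l := by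
  obtain ⟨a, b, c, hab, rfl⟩ := deg1_form l h
  obtain ⟨a', b', c', hab', rfl⟩ := deg1_form l' h'
  rw [evalPt_form] at h1 h2 h3 h4
  have hd : A.1 - B.1 ≠ 0 ∨ A.2 - B.2 ≠ 0 := by
    by_contra hc
    push Not at hc
    exact hAB (Prod.ext (by linarith [hc.1]) (by linarith [hc.2]))
  have e1 : a * (A.1 - B.1) + b * (A.2 - B.2) = 0 := by linarith
  have e2 : a' * (A.1 - B.1) + b' * (A.2 - B.2) = 0 := by linarith
  have det : a * b' = a' * b := by
    rcases hd with hd | hd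
    · apply mul_right_cancel₀ hd; linear_combination b' * e1 - b * e2
    · apply mul_right_cancel₀ hd; linear_combination a * e2 - a' * e1
  have : ∃ k : ℝ, k ≠ 0 ∧ a' = k * a ∧ b' = k * b := by
    rcases hab with ha | hb
    · refine ⟨a' / a, ?_, by field_simp, by field_simp; linarith⟩
      intro h0
      have : a' = 0 := by
        rcases div_eq_zero_iff.1 h0 with h | h
        · exact h
        · exact absurd h ha
      subst this
      rcases hab' with h | h
      · exact h rfl
      · apply h; have : a * b' = 0 := by linarith
        exact (mul_eq_zero.1 this).resolve_left ha
    · refine ⟨b' / b, ?_, by field_simp; linarith, by field_simp⟩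
      intro h0
      have : b' = 0 := by
        rcases div_eq_zero_iff.1 h0 with h | h
        · exact h
        · exact absurd h hb
      subst this
      rcases hab' with h | h
      · apply h; have : a' * b = 0 := by linarith
        exact (mul_eq_zero.1 this).resolve_right hb
      · exact h rfl
  obtain ⟨k, hk, rfl, rfl⟩ := this
  refine ⟨k, hk, ?_⟩
  have : c' = k * c := by linear_combination h3 - k * h1
  subst this
  simp only [C_mul]; ring

lemma line_unique {L L' : Set (ℝ × ℝ)} (h : IsLine L) (h' : IsLine L') {A B : ℝ × ℝ}
    (hAB : A ≠ B) (h1 : A ∈ L) (h2 : B ∈ L) (h3 : A ∈ L') (h4 : B ∈ L') : L = L' := by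
  obtain ⟨l, hl, rfl⟩ := h
  obtain ⟨l', hl', rfl⟩ := h'
  obtain ⟨k, hk, rfl⟩ := deg1_unique l l' hl hl' A B hAB h1 h2 h3 h4
  ext P
  simp [mem_zeroSet, evalPt_mul, evalPt_C, hk]

lemma exists_two_points (l : Poly2) (h : l.totalDegree = 1) :
    ∃ A B : ℝ × ℝ, A ≠ B ∧ evalPt l A = 0 ∧ evalPt l B = 0 := by
  obtain ⟨a, b, c, hab, rfl⟩ := deg1_form l h
  simp only [evalPt_form]
  rcases hab with ha | hb
  · refine ⟨(-c / a, 0), ((-c - b) / a, 1), by simp [Prod.ext_iff], ?_, ?_⟩ <;> field_simp <;> ring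
  · refine ⟨(0, -c / b), (1, (-c - a) / b), by simp [Prod.ext_iff], ?_, ?_⟩ <;> field_simp <;> ring

lemma eq_of_zeroSet_eq (l l' : Poly2) (h : l.totalDegree = 1) (h' : l'.totalDegree = 1)
    (he : zeroSet l = zeroSet l') : ∃ k : ℝ, k ≠ 0 ∧ l' = C k * l := by
  obtain ⟨A, B, hAB, h1, h2⟩ := exists_two_points l h
  have h3 : A ∈ zeroSet l' := he ▸ h1
  have h4 : B ∈ zeroSet l' := he ▸ h2
  exact deg1_unique l l' h h' A B hAB h1 h2 h3 h4

/-- `q` is zero or has total degree `< m`. -/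
def DL (m : ℕ) (q : Poly2) : Prop := q = 0 ∨ q.totalDegree < m

lemma dvd_of_vanish (l q : Poly2) (hl : l.totalDegree = 1) (m : ℕ) (hq : q.totalDegree ≤ m)
    (S : Finset (ℝ × ℝ)) (hS : m + 1 ≤ S.card)
    (h : ∀ A ∈ S, evalPt l A = 0 ∧ evalPt q A = 0) : l ∣ q := by
  obtain ⟨a, b, c, hab, rfl⟩ := deg1_form l hl
  have core : ∀ (u : Fin 2 → Polynomial ℝ) (g : (ℝ × ℝ) → ℝ) (v : Polynomial ℝ →ₐ[ℝ] Poly2),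
      (∀ i, (u i).natDegree ≤ 1) →
      (∀ A, a * A.1 + b * A.2 + c = 0 → (u 0).eval (g A) = A.1 ∧ (u 1).eval (g A) = A.2) →
      (∀ i, (C a * X 0 + C b * X 1 + C c : Poly2) ∣ X i - v (u i)) →
      (C a * X 0 + C b * X 1 + C c : Poly2) ∣ q := by
    intro u g v hu hg hv
    have hz : aeval u q = 0 := by
      by_contra hne
      have hdeg : (aeval u q).natDegree ≤ m := by
        simpa using MvPolynomial.aeval_natDegree_le q hq u hu
      have hinj : Set.InjOn g S := by
        intro A hA B hB hAB
        have hA' := (h A hA).1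
        have hB' := (h B hB).1
        rw [evalPt_form] at hA' hB'
        have e1 := hg A hA'
        have e2 := hg B hB'
        rw [hAB] at e1
        exact Prod.ext (e1.1.symm.trans e2.1) (e1.2.symm.trans e2.2)
      have hsub : S.image g ⊆ (aeval u q).roots.toFinset := by
        intro t ht
        obtain ⟨A, hA, rfl⟩ := Finset.mem_image.1 ht
        rw [Multiset.mem_toFinset, Polynomial.mem_roots hne, Polynomial.IsRoot.def]
        have hA' := (h A hA).1
        rw [evalPt_form] at hA'
        have e1 := hg A hA'
        have h2 := (h A hA).2
        rw [evalPt] at h2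
        have : Polynomial.eval (g A) (aeval u q) = MvPolynomial.eval (fun i => if i = 0 then A.1 else A.2) q := by
          rw [← Polynomial.coe_evalRingHom, MvPolynomial.aeval_def, MvPolynomial.hom_eval₂]
          rw [MvPolynomial.eval, MvPolynomial.coe_eval₂Hom]
          congr 1
          · ext; simp
          · ext i; fin_cases i
            · simpa using e1.1
            · simpa using e1.2
        rw [this, h2]
      have := Finset.card_le_card hsub
      rw [Finset.card_image_of_injOn hinj] at this
      have h3 := Multiset.toFinset_card_le (aeval u q).roots
      have h4 := Polynomial.card_roots' (aeval u q)
      omega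
    have hhom : (Ideal.Quotient.mkₐ ℝ (Ideal.span {(C a * X 0 + C b * X 1 + C c : Poly2)})) =
        (Ideal.Quotient.mkₐ ℝ (Ideal.span {(C a * X 0 + C b * X 1 + C c : Poly2)})).comp
          (v.comp (aeval u)) := by
      apply MvPolynomial.algHom_ext
      intro i
      simp only [AlgHom.comp_apply, aeval_X, Ideal.Quotient.mkₐ_eq_mk]
      rw [Ideal.Quotient.eq, Ideal.mem_span_singleton]
      exact hv i
    have := DFunLike.congr_fun hhom q
    simp only [AlgHom.comp_apply, hz, map_zero, Ideal.Quotient.mkₐ_eq_mk] at this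
    rwa [Ideal.Quotient.eq_zero_iff_mem, Ideal.mem_span_singleton] at this
  by_cases hb : b = 0
  · subst hb
    have ha : a ≠ 0 := by simpa using hab
    refine core ![Polynomial.C (-c / a), Polynomial.X] (fun A => A.2) (Polynomial.aeval (X 1)) ?_ ?_ ?_
    · intro i; fin_cases i <;> simp
    · intro A hA
      simp only [Matrix.cons_val_zero, Matrix.cons_val_one, Polynomial.eval_C, Polynomial.eval_X, and_true]
      field_simp; linarith
    · intro i; fin_cases i
      · refine ⟨C (1 / a), ?_⟩
        have e : (C a : Poly2) * C (1 / a) = 1 := by rw [← C_mul]; simp [ha]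
        have e2 : (C (-c / a) : Poly2) = - C c * C (1 / a) := by
          rw [← C_neg, ← C_mul]; congr 1; field_simp
        simp only [Fin.zero_eta, Matrix.cons_val_zero, Polynomial.aeval_C, algebraMap_eq, e2, C_0]
        linear_combination (- X 0) * e
      · simp
  · refine core ![Polynomial.X, Polynomial.C (-a / b) * Polynomial.X + Polynomial.C (-c / b)]
      (fun A => A.1) (Polynomial.aeval (X 0)) ?_ ?_ ?_
    · intro i; fin_cases i
      · simp
      · exact Polynomial.natDegree_linear_le
    · intro A hA
      simp only [Matrix.cons_val_zero, Matrix.cons_val_one, Polynomial.eval_C, Polynomial.eval_X,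
        Polynomial.eval_add, Polynomial.eval_mul, true_and]
      field_simp; linarith
    · intro i; fin_cases i
      · simp
      · refine ⟨C (1 / b), ?_⟩
        have e : (C b : Poly2) * C (1 / b) = 1 := by rw [← C_mul]; simp [hb]
        have e2 : (C (-c / b) : Poly2) = - C c * C (1 / b) := by
          rw [← C_neg, ← C_mul]; congr 1; field_simp
        have e3 : (C (-a / b) : Poly2) = - C a * C (1 / b) := by
          rw [← C_neg, ← C_mul]; congr 1; field_simp
        simp only [Fin.mk_one, Matrix.cons_val_one, Matrix.cons_val_fin_one, Polynomial.aeval_C, algebraMap_eq, e2, e3,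
          map_add, map_mul, Polynomial.aeval_X]
        linear_combination (- X 1) * e

lemma div_line (l q : Poly2) (hl : l.totalDegree = 1) (m : ℕ) (hq : DL (m + 1) q)
    (S : Finset (ℝ × ℝ)) (hS : m + 1 ≤ S.card)
    (h : ∀ A ∈ S, evalPt l A = 0 ∧ evalPt q A = 0) : ∃ q', q = l * q' ∧ DL m q' := by
  rcases hq with rfl | hq
  · exact ⟨0, by simp, Or.inl rfl⟩
  by_cases h0 : q = 0
  · exact ⟨0, by simp [h0], Or.inl rfl⟩
  obtain ⟨q', rfl⟩ := dvd_of_vanish l q hl m (by omega) S hS h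
  refine ⟨q', rfl, Or.inr ?_⟩
  rw [totalDegree_mul_of_isDomain (left_ne_zero_of_mul h0) (right_ne_zero_of_mul h0), hl] at hq
  omega


open MvPolynomial
open scoped Classical

set_option linter.unusedSimpArgs false
set_option linter.unusedVariables false

/-! ### Covers, removal of maximal lines -/

/-- Points of the plane. -/
abbrev Pt : Type := ℝ × ℝ

/-- Nodes on a line. -/
noncomputable def nd (X : Finset Pt) (L : Set Pt) : Finset Pt := X.filter (fun A => A ∈ L)

/-- Nodes off a line. -/
noncomputable def rm (X : Finset Pt) (L : Set Pt) : Finset Pt := X.filter (fun A => A ∉ L)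

/-- Nodes off a family of lines. -/
noncomputable def rem (X : Finset Pt) (Λ : Finset (Set Pt)) : Finset Pt :=
  X.filter (fun A => ∀ L ∈ Λ, A ∉ L)

/-- Maximal lines as sets. -/
def Mx (n : ℕ) (X : Finset Pt) (L : Set Pt) : Prop := IsLine L ∧ n + 1 ≤ (nd X L).card

/-- Used lines. -/
def Used (n : ℕ) (X : Finset Pt) (L : Set Pt) : Prop :=
  ∃ A ∈ X, ∃ p : Poly2, IsFund n X A p ∧ ∃ g : Poly2, g.totalDegree = 1 ∧ zeroSet g = L ∧ g ∣ p

/-- A factorisation of the fundamental polynomial. -/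
def Facs (n : ℕ) (X : Finset Pt) (A : Pt) (f : Fin n → Poly2) : Prop :=
  (∀ i, (f i).totalDegree = 1) ∧ IsFund n X A (∏ i, f i)

lemma mem_nd {X : Finset Pt} {L : Set Pt} {A : Pt} : A ∈ nd X L ↔ A ∈ X ∧ A ∈ L := by
  simp [nd]

lemma mem_rm {X : Finset Pt} {L : Set Pt} {A : Pt} : A ∈ rm X L ↔ A ∈ X ∧ A ∉ L := by
  simp [rm]

lemma mem_rem {X : Finset Pt} {Λ : Finset (Set Pt)} {A : Pt} :
    A ∈ rem X Λ ↔ A ∈ X ∧ ∀ L ∈ Λ, A ∉ L := by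
  simp [rem]

lemma card_nd_add_rm (X : Finset Pt) (L : Set Pt) : (nd X L).card + (rm X L).card = X.card :=
  Finset.card_filter_add_card_filter_not _

lemma isLine_zeroSet {l : Poly2} (h : l.totalDegree = 1) : IsLine (zeroSet l) := ⟨l, h, rfl⟩

lemma Facs.ne {n : ℕ} {X : Finset Pt} {A : Pt} {f : Fin n → Poly2} (h : Facs n X A f) (i : Fin n) :
    evalPt (f i) A ≠ 0 := by
  intro h0
  have := h.2.2.1
  rw [evalPt_prod, Finset.prod_eq_zero (Finset.mem_univ i) h0] at this
  exact zero_ne_one this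

lemma Facs.cov {n : ℕ} {X : Finset Pt} {A : Pt} {f : Fin n → Poly2} (h : Facs n X A f)
    {B : Pt} (hB : B ∈ X) (hBA : B ≠ A) : ∃ i, evalPt (f i) B = 0 := by
  have := h.2.2.2 B hB hBA
  rw [evalPt_prod, Finset.prod_eq_zero_iff] at this
  obtain ⟨i, -, hi⟩ := this
  exact ⟨i, hi⟩

lemma IsGC.facs {n : ℕ} {X : Finset Pt} (hX : IsGC n X) {A : Pt} (hA : A ∈ X) :
    ∃ f, Facs n X A f := by
  obtain ⟨p, hp, f, hf, rfl⟩ := hX.2 A hA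
  exact ⟨f, hf, hp⟩

/-- The lines of a factorisation. -/
noncomputable def lns {n : ℕ} (f : Fin n → Poly2) : Finset (Set Pt) :=
  Finset.univ.image (fun i => zeroSet (f i))

/-- The covering property. -/
def Cov (n : ℕ) (X : Finset Pt) (A : Pt) (F : Finset (Set Pt)) : Prop :=
  F.card ≤ n ∧ (∀ L ∈ F, IsLine L ∧ A ∉ L ∧ Used n X L) ∧ ∀ B ∈ X, B ≠ A → ∃ L ∈ F, B ∈ L

lemma Facs.cover {n : ℕ} {X : Finset Pt} {A : Pt} (hA : A ∈ X) {f : Fin n → Poly2}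
    (h : Facs n X A f) : Cov n X A (lns f) := by
  refine ⟨?_, ?_, ?_⟩
  · exact Finset.card_image_le.trans (by simp)
  · intro L hL
    obtain ⟨i, -, rfl⟩ := Finset.mem_image.1 hL
    exact ⟨isLine_zeroSet (h.1 i), h.ne i, A, hA, _, h.2, f i, h.1 i, rfl,
      Finset.dvd_prod_of_mem _ (Finset.mem_univ i)⟩
  · intro B hB hBA
    obtain ⟨i, hi⟩ := h.cov hB hBA
    exact ⟨_, Finset.mem_image_of_mem _ (Finset.mem_univ i), hi⟩

lemma IsGC.cover {n : ℕ} {X : Finset Pt} (hX : IsGC n X) {A : Pt} (hA : A ∈ X) :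
    ∃ F, Cov n X A F := by
  obtain ⟨f, hf⟩ := hX.facs hA
  exact ⟨_, hf.cover hA⟩

lemma cover_card {L : Set Pt} (hL : IsLine L) {F : Finset (Set Pt)} (hF : ∀ K ∈ F, IsLine K)
    (hLF : L ∉ F) {S : Finset Pt} (hS : ∀ A ∈ S, A ∈ L) (hc : ∀ A ∈ S, ∃ K ∈ F, A ∈ K) :
    S.card ≤ F.card := by
  choose! φ h1 h2 using hc
  refine Finset.card_le_card_of_injOn φ h1 ?_
  intro A hA B hB hAB
  by_contra hne
  apply hLF
  have : L = φ A := line_unique hL (hF _ (h1 A hA)) hne (hS A hA) (hS B hB) (h2 A hA)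
    (by rw [hAB]; exact h2 B hB)
  rw [this]; exact h1 A hA

lemma mem_of_many {L : Set Pt} (hL : IsLine L) {F : Finset (Set Pt)} (hF : ∀ K ∈ F, IsLine K)
    {S : Finset Pt} (hS : ∀ A ∈ S, A ∈ L) (hc : ∀ A ∈ S, ∃ K ∈ F, A ∈ K)
    (hlt : F.card < S.card) : L ∈ F := by
  by_contra h
  exact absurd (cover_card hL hF h hS hc) (by omega)

/-- Every line of a tight cover meets the covered set. -/
lemma tight_meet {L : Set Pt} (hL : IsLine L) {F : Finset (Set Pt)} (hF : ∀ K ∈ F, IsLine K)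
    (hLF : L ∉ F) {S : Finset Pt} (hS : ∀ A ∈ S, A ∈ L) (hc : ∀ A ∈ S, ∃ K ∈ F, A ∈ K)
    (hle : F.card ≤ S.card) {K : Set Pt} (hK : K ∈ F) : ∃ A ∈ S, A ∈ K := by
  by_contra hcon
  push Not at hcon
  have := cover_card hL (F := F.erase K) (fun K' h => hF K' (Finset.mem_of_mem_erase h))
    (fun h => hLF (Finset.mem_of_mem_erase h)) hS (fun A hA => by
      obtain ⟨K', h1, h2⟩ := hc A hA
      refine ⟨K', Finset.mem_erase.2 ⟨?_, h1⟩, h2⟩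
      rintro rfl; exact hcon A hA h2)
  rw [Finset.card_erase_of_mem hK] at this
  have := Finset.card_pos.2 ⟨K, hK⟩
  omega

/-- Distinct lines of a tight cover share no covered point. -/
lemma tight_disj {L : Set Pt} (hL : IsLine L) {F : Finset (Set Pt)} (hF : ∀ K ∈ F, IsLine K)
    (hLF : L ∉ F) {S : Finset Pt} (hS : ∀ A ∈ S, A ∈ L) (hc : ∀ A ∈ S, ∃ K ∈ F, A ∈ K)
    (hle : F.card ≤ S.card) {K K' : Set Pt} (hK : K ∈ F) (hK' : K' ∈ F) (hne : K ≠ K')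
    {A : Pt} (hA : A ∈ S) (h1 : A ∈ K) (h2 : A ∈ K') : False := by
  obtain ⟨B, hB, hBK⟩ := tight_meet hL (F := F.erase K') (S := S.erase A)
    (fun K' h => hF K' (Finset.mem_of_mem_erase h))
    (fun h => hLF (Finset.mem_of_mem_erase h))
    (fun B hB => hS B (Finset.mem_of_mem_erase hB)) (fun B hB => by
      obtain ⟨hBA, hB⟩ := Finset.mem_erase.1 hB
      obtain ⟨K1, h3, h4⟩ := hc B hB
      refine ⟨K1, Finset.mem_erase.2 ⟨?_, h3⟩, h4⟩
      rintro rfl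
      apply hLF
      rw [line_unique hL (hF _ h3) hBA (hS B hB) (hS A hA) h4 h2]
      exact h3)
    (by rw [Finset.card_erase_of_mem hK', Finset.card_erase_of_mem hA]; omega)
    (Finset.mem_erase.2 ⟨hne, hK⟩)
  obtain ⟨hBA, hB⟩ := Finset.mem_erase.1 hB
  apply hLF
  rw [line_unique hL (hF _ hK) hBA (hS B hB) (hS A hA) hBK h1]
  exact hK

/-- A line contains at most `n+1` nodes. -/
lemma IsGC.card_le {n : ℕ} {X : Finset Pt} (hX : IsGC n X) {L : Set Pt} (hL : IsLine L) :
    (nd X L).card ≤ n + 1 := by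
  by_contra hcon
  push Not at hcon
  obtain ⟨A, hA⟩ := Finset.card_pos.1 (by omega : 0 < (nd X L).card)
  have hA' := mem_nd.1 hA
  obtain ⟨F, hF⟩ := hX.cover hA'.1
  have := mem_of_many hL (F := F) (fun K hK => (hF.2.1 K hK).1) (S := (nd X L).erase A)
    (fun B hB => (mem_nd.1 (Finset.mem_of_mem_erase hB)).2)
    (fun B hB => hF.2.2 B (mem_nd.1 (Finset.mem_of_mem_erase hB)).1 (Finset.ne_of_mem_erase hB))
    (by rw [Finset.card_erase_of_mem hA]; have := hF.1; omega)
  exact (hF.2.1 L this).2.1 hA'.2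

lemma Mx.card {n : ℕ} {X : Finset Pt} {L : Set Pt} (h : Mx n X L) (hX : IsGC n X) :
    (nd X L).card = n + 1 := le_antisymm (hX.card_le h.1) h.2

lemma isGC_of {n : ℕ} {X : Finset Pt} (hp : IsPoised n X)
    (h : ∀ A ∈ X, ∃ f : Fin n → Poly2, (∀ i, (f i).totalDegree = 1 ∧ evalPt (f i) A ≠ 0) ∧
      ∀ B ∈ X, B ≠ A → ∃ i, evalPt (f i) B = 0) : IsGC n X := by
  refine ⟨hp, fun A hA => ?_⟩
  obtain ⟨f, h1, h2⟩ := h A hA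
  have hdeg : ∀ i, (C (evalPt (f i) A)⁻¹ * f i).totalDegree = 1 := by
    intro i
    have h0 : f i ≠ 0 := by
      intro h0; have := (h1 i).1; rw [h0] at this; simp at this
    rw [totalDegree_mul_of_isDomain _ h0, (h1 i).1]
    · simp
    · simp [(h1 i).2]
  refine ⟨∏ i, (C (evalPt (f i) A)⁻¹ * f i), ⟨?_, ?_, ?_⟩, _, hdeg, rfl⟩
  · refine (totalDegree_finsetProd _ _).trans ?_
    simp [hdeg]
  · rw [evalPt_prod]
    apply Finset.prod_eq_one
    intro i _
    rw [evalPt_mul, evalPt_C, inv_mul_cancel₀ (h1 i).2]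
  · intro B hB hBA
    obtain ⟨i, hi⟩ := h2 B hB hBA
    rw [evalPt_prod]
    apply Finset.prod_eq_zero (Finset.mem_univ i)
    rw [evalPt_mul, hi, mul_zero]

lemma IsGC.rm {n : ℕ} {X : Finset Pt} (hX : IsGC (n + 1) X) {L : Set Pt} (hL : Mx (n + 1) X L) :
    IsGC n (rm X L) := by
  have hcard := hL.card hX
  obtain ⟨l, hl, rfl⟩ := hL.1
  apply isGC_of
  · refine ⟨?_, ?_⟩
    · have h1 := card_nd_add_rm X (zeroSet l)
      have h2 : X.card = (n + 3).choose 2 := hX.1.1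
      have h3 : (n + 3).choose 2 = (n + 2).choose 1 + (n + 2).choose 2 := Nat.choose_succ_succ _ _
      rw [Nat.choose_one_right] at h3
      omega
    · intro q hq hv
      have : l * q = 0 := by
        apply hX.1.2
        · exact (totalDegree_mul _ _).trans (by omega)
        · intro A hA
          rw [evalPt_mul]
          by_cases h0 : A ∈ zeroSet l
          · rw [show evalPt l A = 0 from h0, zero_mul]
          · rw [hv A (mem_rm.2 ⟨hA, h0⟩), mul_zero]
      rcases mul_eq_zero.1 this with h0 | h0
      · rw [h0] at hl; simp at hl
      · exact h0
  · intro A hA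
    obtain ⟨hA, hAl⟩ := mem_rm.1 hA
    obtain ⟨f, hf⟩ := hX.facs hA
    have hF := hf.cover hA
    have hm : zeroSet l ∈ lns f := mem_of_many hL.1 (fun K hK => (hF.2.1 K hK).1)
      (S := nd X (zeroSet l)) (fun B hB => (mem_nd.1 hB).2)
      (fun B hB => hF.2.2 B (mem_nd.1 hB).1 (by rintro rfl; exact hAl (mem_nd.1 hB).2))
      (by have := hF.1; omega)
    obtain ⟨i, -, hi⟩ := Finset.mem_image.1 hm
    refine ⟨fun j => f (i.succAbove j), fun j => ⟨hf.1 _, hf.ne _⟩, ?_⟩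
    intro B hB hBA
    obtain ⟨hB, hBl⟩ := mem_rm.1 hB
    obtain ⟨j, hj⟩ := hf.cov hB hBA
    have hji : j ≠ i := by
      rintro rfl
      apply hBl; rw [← hi]; exact hj
    obtain ⟨k, rfl⟩ := Fin.exists_succAbove_eq hji
    exact ⟨k, hj⟩

lemma evalPt_prod_ne {m : ℕ} (h : Fin m → Poly2) (P : Pt) (hh : ∀ i, evalPt (h i) P ≠ 0) :
    evalPt (∏ i, h i) P ≠ 0 := by
  rw [evalPt_prod]; exact Finset.prod_ne_zero_iff.2 (fun i _ => hh i)

lemma totalDegree_prod_le {m : ℕ} (h : Fin m → Poly2) (hh : ∀ i, (h i).totalDegree = 1) :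
    (∏ i, h i).totalDegree ≤ m := by
  refine (totalDegree_finsetProd _ _).trans ?_
  simp [hh]

/-- Setup facts for `lemma_J`. -/
lemma J_aux {m : ℕ} {X : Finset Pt} {A c : Pt} {f : Fin (m + 1) → Poly2}
    (hf : Facs (m + 1) X A f) {L N : Set Pt} (hL : IsLine L) (hN : IsLine N)
    (hLc : m + 2 ≤ (nd X L).card) (hNc : m + 1 ≤ (nd X N).card)
    (hA : A ∈ X) (hAL : A ∈ L) (hdisj : ∀ P ∈ X, P ∈ L → P ∉ N)
    (hcN : c ∈ N) (hcX : c ∈ X) {i : Fin (m + 1)} (hi : evalPt (f i) c = 0) :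
    (∀ j, zeroSet (f j) ≠ N) ∧ (∀ j, evalPt (f (i.succAbove j)) c ≠ 0) ∧
    (∀ P ∈ X, P ∈ N → P ≠ c → evalPt (∏ j, f (i.succAbove j)) P = 0) := by
  have hF := hf.cover hA
  have hfl : ∀ s : Finset (Fin (m + 1)), ∀ K ∈ s.image (fun i => zeroSet (f i)), IsLine K := by
    intro s K hK
    obtain ⟨j, -, rfl⟩ := Finset.mem_image.1 hK
    exact isLine_zeroSet (hf.1 j)
  have hneL : ∀ j, zeroSet (f j) ≠ L := by
    rintro j rfl
    exact hf.ne j hAL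
  have h1 : ∀ j, zeroSet (f j) ≠ N := by
    rintro j hj
    have := cover_card hL (hfl (Finset.univ.erase j)) (S := (nd X L).erase A) (by
        intro h
        obtain ⟨k, -, hk⟩ := Finset.mem_image.1 h
        exact hneL k hk)
      (fun B hB => (mem_nd.1 (Finset.mem_of_mem_erase hB)).2)
      (fun B hB => by
        obtain ⟨hBA, hB⟩ := Finset.mem_erase.1 hB
        obtain ⟨hBX, hBL⟩ := mem_nd.1 hB
        obtain ⟨k, hk⟩ := hf.cov hBX hBA
        refine ⟨_, Finset.mem_image_of_mem _ (Finset.mem_erase.2 ⟨?_, Finset.mem_univ k⟩), hk⟩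
        rintro rfl
        apply hdisj B hBX hBL
        rw [← hj]; exact hk)
    rw [Finset.card_erase_of_mem (mem_nd.2 ⟨hA, hAL⟩)] at this
    have h2 := (Finset.card_image_le (s := Finset.univ.erase j) (f := fun i => zeroSet (f i)))
    rw [Finset.card_erase_of_mem (Finset.mem_univ j), Finset.card_univ, Fintype.card_fin] at h2
    omega
  have hcA : ∀ P ∈ X, P ∈ N → P ≠ A := by
    rintro P hP hPN rfl
    exact hdisj P hP hAL hPN
  have hcov : ∀ P ∈ X, P ∈ N → P ≠ c → ∀ j, evalPt (f j) P = 0 → evalPt (f j) c ≠ 0 := by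
    intro P hP hPN hPc j hj hjc
    exact h1 j (line_unique (isLine_zeroSet (hf.1 j)) hN hPc hj hjc hPN hcN)
  refine ⟨h1, ?_, ?_⟩
  · intro k hk
    have := cover_card hN (hfl ((Finset.univ.erase i).erase (i.succAbove k)))
      (S := (nd X N).erase c) (by
        intro h
        obtain ⟨k, -, hk⟩ := Finset.mem_image.1 h
        exact h1 k hk)
      (fun B hB => (mem_nd.1 (Finset.mem_of_mem_erase hB)).2)
      (fun B hB => by
        obtain ⟨hBc, hB⟩ := Finset.mem_erase.1 hB
        obtain ⟨hBX, hBN⟩ := mem_nd.1 hB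
        obtain ⟨t, ht⟩ := hf.cov hBX (hcA B hBX hBN)
        have := hcov B hBX hBN hBc t ht
        refine ⟨_, Finset.mem_image_of_mem _ (Finset.mem_erase.2 ⟨?_, Finset.mem_erase.2
          ⟨?_, Finset.mem_univ t⟩⟩), ht⟩
        · rintro rfl; exact this hk
        · rintro rfl; exact this hi)
    rw [Finset.card_erase_of_mem (mem_nd.2 ⟨hcX, hcN⟩)] at this
    have h2 := (Finset.card_image_le (s := (Finset.univ.erase i).erase (i.succAbove k))
      (f := fun i => zeroSet (f i)))
    have hne : i.succAbove k ≠ i := Fin.succAbove_ne i k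
    rw [Finset.card_erase_of_mem (Finset.mem_erase.2 ⟨hne, Finset.mem_univ _⟩),
      Finset.card_erase_of_mem (Finset.mem_univ i), Finset.card_univ, Fintype.card_fin] at h2
    have : 0 < m := Fin.pos k
    omega
  · intro P hP hPN hPc
    obtain ⟨t, ht⟩ := hf.cov hP (hcA P hP hPN)
    have hti : t ≠ i := by
      rintro rfl
      exact hcov P hP hPN hPc t ht hi
    obtain ⟨k, rfl⟩ := Fin.exists_succAbove_eq hti
    rw [evalPt_prod]
    exact Finset.prod_eq_zero (Finset.mem_univ k) ht

lemma fac_other {m : ℕ} {X : Finset Pt} {A P : Pt} {f : Fin (m + 1) → Poly2}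
    (hf : Facs (m + 1) X A f) (i : Fin (m + 1)) (hP : P ∈ X) (hPA : P ≠ A)
    (hi : evalPt (f i) P ≠ 0) : evalPt (∏ j, f (i.succAbove j)) P = 0 := by
  obtain ⟨t, ht⟩ := hf.cov hP hPA
  have hti : t ≠ i := by
    rintro rfl
    exact hi ht
  obtain ⟨k, rfl⟩ := Fin.exists_succAbove_eq hti
  rw [evalPt_prod]
  exact Finset.prod_eq_zero (Finset.mem_univ k) ht

lemma lemma_J {n : ℕ} {X : Finset Pt} {A B c : Pt} {f g : Fin n → Poly2}
    (hf : Facs n X A f) (hg : Facs n X B g) {L N N' : Set Pt}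
    (hL : IsLine L) (hN : IsLine N) (hN' : IsLine N') (hNN : N ≠ N')
    (hLc : n + 1 ≤ (nd X L).card) (hNc : n ≤ (nd X N).card) (hNc' : n ≤ (nd X N').card)
    (hA : A ∈ X) (hAL : A ∈ L) (hB : B ∈ X) (hBL : B ∈ L) (hAB : A ≠ B)
    (hdisj : ∀ P ∈ X, P ∈ L → P ∉ N) (hdisj' : ∀ P ∈ X, P ∈ L → P ∉ N')
    (hcN : c ∈ N) (hcN' : c ∈ N') (hcX : c ∈ X) {i j : Fin n} (hi : evalPt (f i) c = 0)
    (hij : zeroSet (f i) = zeroSet (g j)) : False := by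
  obtain ⟨m, rfl⟩ : ∃ m, n = m + 1 := ⟨n - 1, by have := i.pos; omega⟩
  have hj : evalPt (g j) c = 0 := by
    have : c ∈ zeroSet (g j) := hij ▸ hi
    exact this
  obtain ⟨a1, a2, a3⟩ := J_aux hf hL hN hLc hNc hA hAL hdisj hcN hcX hi
  obtain ⟨a1', a2', a3'⟩ := J_aux hf hL hN' hLc hNc' hA hAL hdisj' hcN' hcX hi
  obtain ⟨b1, b2, b3⟩ := J_aux hg hL hN hLc hNc hB hBL hdisj hcN hcX hj
  obtain ⟨b1', b2', b3'⟩ := J_aux hg hL hN' hLc hNc' hB hBL hdisj' hcN' hcX hj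
  set gA : Poly2 := ∏ k, f (i.succAbove k) with hgA
  set gB : Poly2 := ∏ k, g (j.succAbove k) with hgB
  have dA : gA.totalDegree ≤ m := totalDegree_prod_le _ (fun k => hf.1 _)
  have dB : gB.totalDegree ≤ m := totalDegree_prod_le _ (fun k => hg.1 _)
  have cA : evalPt gA c ≠ 0 := evalPt_prod_ne _ _ a2
  have cB : evalPt gB c ≠ 0 := evalPt_prod_ne _ _ b2
  set h : Poly2 := C (evalPt gB c) * gA - C (evalPt gA c) * gB with hh
  have ev : ∀ P, evalPt h P = evalPt gB c * evalPt gA P - evalPt gA c * evalPt gB P := by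
    intro P; rw [hh, evalPt_sub, evalPt_mul, evalPt_mul, evalPt_C, evalPt_C]
  have hd : DL (m + 1) h := by
    right
    refine Nat.lt_succ_of_le ((totalDegree_sub _ _).trans (max_le ?_ ?_))
    · exact (totalDegree_mul _ _).trans (by simpa using dA)
    · exact (totalDegree_mul _ _).trans (by simpa using dB)
  have rA : evalPt (f i) A ≠ 0 := hf.ne i
  have rB : evalPt (f i) B ≠ 0 := by
    intro h0
    have : B ∈ zeroSet (g j) := hij ▸ h0
    exact hg.ne j this
  have rA' : evalPt (g j) A ≠ 0 := by
    intro h0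
    have : A ∈ zeroSet (f i) := by rw [hij]; exact h0
    exact rA this
  have hAne : evalPt h A ≠ 0 := by
    rw [ev, fac_other hg j hA hAB rA', mul_zero, sub_zero]
    exact mul_ne_zero cB (evalPt_prod_ne _ _ (fun k => hf.ne _))
  have hc0 : evalPt h c = 0 := by rw [ev]; ring
  have hN0 : ∀ P ∈ X, P ∈ N → evalPt h P = 0 := by
    intro P hP hPN
    by_cases hPc : P = c
    · rw [hPc, hc0]
    · rw [ev, a3 P hP hPN hPc, b3 P hP hPN hPc]; ring
  have hN0' : ∀ P ∈ X, P ∈ N' → evalPt h P = 0 := by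
    intro P hP hPN
    by_cases hPc : P = c
    · rw [hPc, hc0]
    · rw [ev, a3' P hP hPN hPc, b3' P hP hPN hPc]; ring
  have hL0 : ∀ P ∈ X, P ∈ L → P ≠ A → P ≠ B → evalPt (f i) P ≠ 0 → evalPt h P = 0 := by
    intro P hP hPL hPA hPB hPr
    have hPr' : evalPt (g j) P ≠ 0 := by
      intro h0
      have : P ∈ zeroSet (f i) := by rw [hij]; exact h0
      exact hPr this
    rw [ev, fac_other hf i hP hPA hPr, fac_other hg j hP hPB hPr']; ring
  clear_value h
  obtain ⟨l, hl, rfl⟩ := hL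
  obtain ⟨v, hv, rfl⟩ := hN
  obtain ⟨w, hw, rfl⟩ := hN'
  obtain ⟨h1, e1, d1⟩ := div_line v h hv m hd (nd X (zeroSet v)) hNc
    (fun P hP => ⟨(mem_nd.1 hP).2, hN0 P (mem_nd.1 hP).1 (mem_nd.1 hP).2⟩)
  have zero_case : h1 ≠ 0 := by
    rintro rfl
    apply hAne; rw [e1]; simp [evalPt]
  obtain ⟨m', rfl⟩ : ∃ m', m = m' + 1 := by
    rcases d1 with d1 | d1
    · exact absurd d1 zero_case
    · exact ⟨m - 1, by omega⟩
  obtain ⟨h2, e2, d2⟩ := div_line w h1 hw m' d1 ((nd X (zeroSet w)).erase c)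
    (by rw [Finset.card_erase_of_mem (mem_nd.2 ⟨hcX, hcN'⟩)]; omega)
    (fun P hP => by
      obtain ⟨hPc, hP⟩ := Finset.mem_erase.1 hP
      obtain ⟨hPX, hPw⟩ := mem_nd.1 hP
      refine ⟨hPw, ?_⟩
      have := hN0' P hPX hPw
      rw [e1, evalPt_mul] at this
      refine (mul_eq_zero.1 this).resolve_left ?_
      intro h0
      exact hNN (line_unique (isLine_zeroSet hv) (isLine_zeroSet hw) hPc h0 hcN hPw hcN'))
  have zero_case2 : h2 ≠ 0 := by
    rintro rfl
    apply zero_case; rw [e2]; simp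
  obtain ⟨m'', rfl⟩ : ∃ m'', m' = m'' + 1 := by
    rcases d2 with d2 | d2
    · exact absurd d2 zero_case2
    · exact ⟨m' - 1, by omega⟩
  -- nodes of L other than A, B and those on r
  have hrl : (nd (nd X (zeroSet l)) (zeroSet (f i))).card ≤ 1 := by
    rw [Finset.card_le_one]
    intro P hP Q hQ
    by_contra hne
    obtain ⟨hP1, hP2⟩ := mem_nd.1 hP
    obtain ⟨hQ1, hQ2⟩ := mem_nd.1 hQ
    have : zeroSet (f i) = zeroSet l := line_unique (isLine_zeroSet (hf.1 i)) (isLine_zeroSet hl) hne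
      hP2 hQ2 (mem_nd.1 hP1).2 (mem_nd.1 hQ1).2
    apply rA
    have : A ∈ zeroSet (f i) := by rw [this]; exact hAL
    exact this
  have hcr := card_nd_add_rm (nd X (zeroSet l)) (zeroSet (f i))
  obtain ⟨h3, e3, d3⟩ := div_line l h2 hl m'' d2
    (((rm (nd X (zeroSet l)) (zeroSet (f i))).erase A).erase B)
    (by
      have := Finset.pred_card_le_card_erase (s := (rm (nd X (zeroSet l)) (zeroSet (f i)))) (a := A)
      have := Finset.pred_card_le_card_erase
        (s := (rm (nd X (zeroSet l)) (zeroSet (f i))).erase A) (a := B)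
      omega)
    (fun P hP => by
      obtain ⟨hPB, hP⟩ := Finset.mem_erase.1 hP
      obtain ⟨hPA, hP⟩ := Finset.mem_erase.1 hP
      obtain ⟨hP, hPr⟩ := mem_rm.1 hP
      obtain ⟨hPX, hPl⟩ := mem_nd.1 hP
      refine ⟨hPl, ?_⟩
      have := hL0 P hPX hPl hPA hPB hPr
      rw [e1, e2, evalPt_mul, evalPt_mul] at this
      exact ((mul_eq_zero.1 ((mul_eq_zero.1 this).resolve_left (hdisj P hPX hPl))).resolve_left
        (hdisj' P hPX hPl)))
  apply hAne
  rw [e1, e2, e3]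
  simp only [evalPt_mul]
  rw [show evalPt l A = 0 from hAL]; ring


open MvPolynomial
open scoped Classical

set_option linter.unusedSimpArgs false
set_option linter.unusedVariables false

/-! ### Maximal lines -/

lemma Cov.mem {n : ℕ} {X : Finset Pt} {A : Pt} {F : Finset (Set Pt)} (hF : Cov n X A F)
    {L : Set Pt} (hL : Mx n X L) (hA : A ∉ L) : L ∈ F :=
  mem_of_many hL.1 (fun K hK => (hF.2.1 K hK).1) (S := nd X L) (fun B hB => (mem_nd.1 hB).2)
    (fun B hB => hF.2.2 B (mem_nd.1 hB).1 (by rintro rfl; exact hA (mem_nd.1 hB).2))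
    (by have := hF.1; have := hL.2; omega)

lemma Cov.not_mem {n : ℕ} {X : Finset Pt} {A : Pt} {F : Finset (Set Pt)} (hF : Cov n X A F)
    {L N : Set Pt} (hL : Mx n X L) (hAX : A ∈ X) (hA : A ∈ L)
    (hN : ∀ P ∈ X, P ∈ L → P ∉ N) : N ∉ F := by
  intro hNF
  have := cover_card hL.1 (F := F.erase N) (fun K hK => (hF.2.1 K (Finset.mem_of_mem_erase hK)).1)
    (fun h => (hF.2.1 L (Finset.mem_of_mem_erase h)).2.1 hA)
    (S := (nd X L).erase A) (fun B hB => (mem_nd.1 (Finset.mem_of_mem_erase hB)).2)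
    (fun B hB => by
      obtain ⟨hBA, hB⟩ := Finset.mem_erase.1 hB
      obtain ⟨hBX, hBL⟩ := mem_nd.1 hB
      obtain ⟨K, hK, hBK⟩ := hF.2.2 B hBX hBA
      refine ⟨K, Finset.mem_erase.2 ⟨?_, hK⟩, hBK⟩
      rintro rfl
      exact hN B hBX hBL hBK)
  rw [Finset.card_erase_of_mem hNF, Finset.card_erase_of_mem (mem_nd.2 ⟨hAX, hA⟩)] at this
  have := hF.1
  have := hL.2
  have := Finset.card_pos.2 ⟨N, hNF⟩
  omega

lemma Mx.nonempty {n : ℕ} {X : Finset Pt} {L : Set Pt} (h : Mx n X L) : ∃ A ∈ X, A ∈ L := by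
  obtain ⟨A, hA⟩ := Finset.card_pos.1 (by have := h.2; omega : 0 < (nd X L).card)
  exact ⟨A, mem_nd.1 hA⟩

/-- Two maximal lines meet at a node. -/
lemma G3 {n : ℕ} {X : Finset Pt} (hX : IsGC n X) {K L : Set Pt} (hK : Mx n X K) (hL : Mx n X L) :
    ∃ P ∈ X, P ∈ K ∧ P ∈ L := by
  by_contra hcon
  push Not at hcon
  obtain ⟨A, hA, hAK⟩ := hK.nonempty
  obtain ⟨F, hF⟩ := hX.cover hA
  exact hF.not_mem hK hA hAK hcon (hF.mem hL (hcon A hA hAK))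

lemma common_le_one {K L : Set Pt} (hK : IsLine K) (hL : IsLine L) (hne : K ≠ L) (S : Finset Pt)
    (hS : ∀ P ∈ S, P ∈ K ∧ P ∈ L) : S.card ≤ 1 := by
  rw [Finset.card_le_one]
  intro P hP Q hQ
  by_contra h
  exact hne (line_unique hK hL h (hS P hP).1 (hS Q hQ).1 (hS P hP).2 (hS Q hQ).2)

lemma meet_unique {K L : Set Pt} (hK : IsLine K) (hL : IsLine L) (hne : K ≠ L) {P Q : Pt}
    (h1 : P ∈ K) (h2 : P ∈ L) (h3 : Q ∈ K) (h4 : Q ∈ L) : P = Q := by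
  by_contra h
  exact hne (line_unique hK hL h h1 h3 h2 h4)

/-- No three concurrent maximal lines. -/
lemma G4 {n : ℕ} (hn : 1 ≤ n) {X : Finset Pt} (hX : IsGC n X) {K L M : Set Pt} (hK : Mx n X K)
    (hL : Mx n X L) (hM : Mx n X M) (hKL : K ≠ L) (hKM : K ≠ M) (hLM : L ≠ M) {P : Pt}
    (h1 : P ∈ K) (h2 : P ∈ L) (h3 : P ∈ M) : False := by
  have hPX : P ∈ X := by
    obtain ⟨Q, hQ, hQK, hQL⟩ := G3 hX hK hL
    rwa [meet_unique hK.1 hL.1 hKL h1 h2 hQK hQL]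
  obtain ⟨A, hA⟩ := Finset.card_pos.1 (by
    rw [Finset.card_erase_of_mem (mem_nd.2 ⟨hPX, h1⟩)]
    have := hK.2
    omega : 0 < ((nd X K).erase P).card)
  obtain ⟨hAP, hA⟩ := Finset.mem_erase.1 hA
  obtain ⟨hAX, hAK⟩ := mem_nd.1 hA
  obtain ⟨F, hF⟩ := hX.cover hAX
  have hAL : A ∉ L := fun h => hAP (meet_unique hK.1 hL.1 hKL hAK h h1 h2)
  have hAM : A ∉ M := fun h => hAP (meet_unique hK.1 hM.1 hKM hAK h h1 h3)
  refine tight_disj hK.1 (F := F) (fun K hK => (hF.2.1 K hK).1) (fun h => (hF.2.1 K h).2.1 hAK)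
    (S := (nd X K).erase A) (fun B hB => (mem_nd.1 (Finset.mem_of_mem_erase hB)).2)
    (fun B hB => hF.2.2 B (mem_nd.1 (Finset.mem_of_mem_erase hB)).1 (Finset.ne_of_mem_erase hB))
    ?_ (hF.mem hL hAL) (hF.mem hM hAM) hLM (A := P)
    (Finset.mem_erase.2 ⟨hAP.symm, mem_nd.2 ⟨hPX, h1⟩⟩) h2 h3
  rw [Finset.card_erase_of_mem hA]
  have := hF.1
  have := hK.2
  omega

lemma card_maxlines {n : ℕ} (hn : 1 ≤ n) {X : Finset Pt} (hX : IsGC n X) (Λ : Finset (Set Pt))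
    (hΛ : ∀ L ∈ Λ, Mx n X L) : Λ.card ≤ n + 2 := by
  by_contra hcon
  push Not at hcon
  obtain ⟨L, hL⟩ := Finset.card_pos.1 (by omega : 0 < Λ.card)
  have h : ∀ K ∈ Λ.erase L, ∃ P, P ∈ X ∧ P ∈ L ∧ P ∈ K := by
    intro K hK
    obtain ⟨P, h1, h2, h3⟩ := G3 hX (hΛ L hL) (hΛ K (Finset.mem_of_mem_erase hK))
    exact ⟨P, h1, h2, h3⟩
  choose! φ h1 h2 h3 using h
  have := Finset.card_le_card_of_injOn (t := nd X L) φ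
    (fun K hK => mem_nd.2 ⟨h1 K hK, h2 K hK⟩) (by
      intro K hK K' hK' he
      by_contra hne
      obtain ⟨a, b⟩ := Finset.mem_erase.1 hK
      obtain ⟨a', b'⟩ := Finset.mem_erase.1 hK'
      exact G4 hn hX (hΛ L hL) (hΛ K b) (hΛ K' b') a.symm a'.symm hne (h2 K hK) (h3 K hK)
        (by rw [he]; exact h3 K' hK'))
  rw [Finset.card_erase_of_mem hL] at this
  have := hX.card_le (hΛ L hL).1
  omega

lemma exists_maxlines {n : ℕ} (hn : 1 ≤ n) {X : Finset Pt} (hX : IsGC n X) :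
    ∃ Λ : Finset (Set Pt), ∀ L, L ∈ Λ ↔ Mx n X L := by
  have hfin : {L | Mx n X L}.Finite := by
    by_contra h
    obtain ⟨t, ht, hc⟩ := Set.Infinite.exists_subset_card_eq h (n + 3)
    have := card_maxlines hn hX t (fun L hL => ht hL)
    omega
  exact ⟨hfin.toFinset, fun L => by simp⟩

lemma Mx.stay {n : ℕ} {X : Finset Pt} {K L : Set Pt} (hK : IsLine K) (hL : Mx (n + 1) X L)
    (hne : L ≠ K) : Mx n (rm X K) L := by
  refine ⟨hL.1, ?_⟩
  have h1 := card_nd_add_rm (nd X L) K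
  have h2 := common_le_one hK hL.1 hne.symm (nd (nd X L) K) (fun P hP =>
    ⟨(mem_nd.1 hP).2, (mem_nd.1 (mem_nd.1 hP).1).2⟩)
  have h3 : rm (nd X L) K = nd (rm X K) L := by
    ext P; simp only [mem_rm, mem_nd]; tauto
  rw [h3] at h1
  have := hL.2
  omega

lemma rem_empty (X : Finset Pt) : rem X ∅ = X := by ext; simp [mem_rem]

lemma rem_insert (X : Finset Pt) (L : Set Pt) (Λ : Finset (Set Pt)) :
    rem X (insert L Λ) = rm (rem X Λ) L := by
  ext; simp [mem_rem, mem_rm]; tauto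

lemma rem_subset_rem {X : Finset Pt} {I Λ : Finset (Set Pt)} (h : I ⊆ Λ) : rem X Λ ⊆ rem X I := by
  intro A hA
  rw [mem_rem] at hA ⊢
  exact ⟨hA.1, fun L hL => hA.2 L (h hL)⟩

lemma rem_gc {n : ℕ} {X : Finset Pt} (hX : IsGC n X) (Λ : Finset (Set Pt)) :
    ∀ m, (∀ L ∈ Λ, Mx n X L) → m + Λ.card = n →
    IsGC m (rem X Λ) ∧ ∀ L, Mx n X L → L ∉ Λ → Mx m (rem X Λ) L := by
  induction Λ using Finset.induction_on with
  | empty =>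
    intro m _ hm
    simp only [Finset.card_empty, add_zero] at hm
    subst hm
    rw [rem_empty]
    exact ⟨hX, fun L h _ => h⟩
  | insert K Λ hK ih =>
    intro m hΛ hm
    rw [Finset.card_insert_of_notMem hK] at hm
    obtain ⟨h1, h2⟩ := ih (m + 1) (fun L hL => hΛ L (Finset.mem_insert_of_mem hL)) (by omega)
    rw [rem_insert]
    refine ⟨h1.rm (h2 K (hΛ K (Finset.mem_insert_self _ _)) hK), ?_⟩
    intro L hL hLn
    rw [Finset.mem_insert, not_or] at hLn
    exact (h2 L hL hLn.2).stay (hΛ K (Finset.mem_insert_self _ _)).1 hLn.1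

lemma Mx.lift {n : ℕ} {X : Finset Pt} {K L : Set Pt} (h : Mx n (rm X K) L)
    {P : Pt} (hP : P ∈ X) (hPK : P ∈ K) (hPL : P ∈ L) : Mx (n + 1) X L := by
  refine ⟨h.1, ?_⟩
  have h1 : nd (rm X K) L ⊆ (nd X L).erase P := by
    intro Q hQ
    obtain ⟨a, b⟩ := mem_nd.1 hQ
    obtain ⟨c, d⟩ := mem_rm.1 a
    exact Finset.mem_erase.2 ⟨by rintro rfl; exact d hPK, mem_nd.2 ⟨c, b⟩⟩
  have h2 := Finset.card_le_card h1
  rw [Finset.card_erase_of_mem (mem_nd.2 ⟨hP, hPL⟩)] at h2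
  have := h.2
  omega

lemma Mx.ne_of_rm {n : ℕ} {X : Finset Pt} {K L : Set Pt} (h : Mx n (rm X K) L) : L ≠ K := by
  rintro rfl
  obtain ⟨A, hA, hAL⟩ := h.nonempty
  exact (mem_rm.1 hA).2 hAL

lemma nd_rm_sub (X : Finset Pt) (K L : Set Pt) : nd (rm X K) L ⊆ nd X L := by
  intro P hP
  obtain ⟨a, b⟩ := mem_nd.1 hP
  exact mem_nd.2 ⟨(mem_rm.1 a).1, b⟩

lemma key' {n : ℕ} (hn : 1 ≤ n) {X : Finset Pt} (hX : IsGC (n + 1) X) {L N N' M : Set Pt}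
    (hL : Mx (n + 1) X L) (hN : Mx n (rm X L) N) (hN' : Mx n (rm X L) N') (hM : Mx n (rm X L) M)
    (h12 : N ≠ N') (h13 : N ≠ M) (h23 : N' ≠ M) : Mx (n + 1) X N ∨ Mx (n + 1) X N' := by
  by_contra hcon
  push Not at hcon
  have hd : ∀ P ∈ X, P ∈ L → P ∉ N := fun P hP hPL hPN => hcon.1 (hN.lift hP hPL hPN)
  have hd' : ∀ P ∈ X, P ∈ L → P ∉ N' := fun P hP hPL hPN => hcon.2 (hN'.lift hP hPL hPN)
  have hR := hX.rm hL
  obtain ⟨c, hc, hcN, hcN'⟩ := G3 hR hN hN'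
  obtain ⟨hcX, hcL⟩ := mem_rm.1 hc
  have hcM : c ∉ M := fun h => G4 hn hR hN hN' hM h12 h13 h23 hcN hcN' h
  have hfac : ∀ A, A ∈ nd X L → ∃ f : Fin (n + 1) → Poly2, Facs (n + 1) X A f :=
    fun A hA => hX.facs (mem_nd.1 hA).1
  choose! f hf using hfac
  have hr : ∀ A, A ∈ nd X L → ∃ i, evalPt (f A i) c = 0 := by
    intro A hA
    exact (hf A hA).cov hcX (by rintro rfl; exact hcL (mem_nd.1 hA).2)
  choose! i hi using hr
  have hJ : ∀ A ∈ nd X L, ∀ B ∈ nd X L, zeroSet (f A (i A)) = zeroSet (f B (i B)) → A = B := by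
    intro A hA B hB he
    by_contra hAB
    exact lemma_J (hf A hA) (hf B hB) hL.1 hN.1 hN'.1 h12 hL.2
      (hN.2.trans (Finset.card_le_card (nd_rm_sub X L N)))
      (hN'.2.trans (Finset.card_le_card (nd_rm_sub X L N')))
      (mem_nd.1 hA).1 (mem_nd.1 hA).2 (mem_nd.1 hB).1 (mem_nd.1 hB).2 hAB hd hd' hcN hcN' hcX
      (hi A hA) he
  have hline : ∀ A ∈ nd X L, IsLine (zeroSet (f A (i A))) :=
    fun A hA => isLine_zeroSet ((hf A hA).1 _)
  have hmem : ∀ A, zeroSet (f A (i A)) ∈ lns (f A) :=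
    fun A => Finset.mem_image_of_mem _ (Finset.mem_univ _)
  have hneM : ∀ A ∈ nd X L, zeroSet (f A (i A)) ≠ M := by
    intro A hA h
    apply hcM; rw [← h]; exact hi A hA
  have hMcard := hM.card hR
  have hLcard := hL.card hX
  have inj : ∀ T : Pt → Pt, (∀ A ∈ nd X L, T A ∈ zeroSet (f A (i A)) ∧ T A ≠ c) →
      Set.InjOn T (nd X L : Finset Pt) := by
    intro T hT A hA B hB he
    apply hJ A hA B hB
    exact line_unique (hline A hA) (hline B hB) (hT A hA).2 (hT A hA).1 (hi A hA)
      (by rw [he]; exact (hT B hB).1) (hi B hB)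
  by_cases hB : ∃ B ∈ X, B ∈ L ∧ B ∈ M
  · obtain ⟨B, hBX, hBL, hBM⟩ := hB
    have hMX : Mx (n + 1) X M := hM.lift hBX hBL hBM
    have hT : ∀ A ∈ nd X L, ∃ Q, Q ∈ (nd X L).erase B ∧ Q ∈ zeroSet (f A (i A)) := by
      intro A hA
      have hF := (hf A hA).cover (mem_nd.1 hA).1
      have a1 : L ∉ lns (f A) := fun h => (hF.2.1 L h).2.1 (mem_nd.1 hA).2
      have a2 : ∀ B ∈ (nd X L).erase A, B ∈ L :=
        fun B hB => (mem_nd.1 (Finset.mem_of_mem_erase hB)).2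
      have a3 : ∀ B ∈ (nd X L).erase A, ∃ K ∈ lns (f A), B ∈ K := fun B hB => hF.2.2 B
        (mem_nd.1 (Finset.mem_of_mem_erase hB)).1 (Finset.ne_of_mem_erase hB)
      have a4 : (lns (f A)).card ≤ ((nd X L).erase A).card := by
        rw [Finset.card_erase_of_mem hA]; have := hF.1; omega
      obtain ⟨Q, hQ, hQr⟩ := tight_meet hL.1 (fun K hK => (hF.2.1 K hK).1) a1 a2 a3 a4 (hmem A)
      obtain ⟨hQA, hQL⟩ := Finset.mem_erase.1 hQ
      refine ⟨Q, Finset.mem_erase.2 ⟨?_, hQL⟩, hQr⟩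
      rintro rfl
      have hAM : A ∉ M := fun h => hQA (meet_unique hL.1 hM.1 hM.ne_of_rm.symm hBL hBM
        (mem_nd.1 hA).2 h)
      exact tight_disj hL.1 (fun K hK => (hF.2.1 K hK).1) a1 a2 a3 a4 (hmem A)
        (hF.mem hMX hAM) (hneM A hA) hQ hQr hBM
    choose! T hT1 hT2 using hT
    have := Finset.card_le_card_of_injOn T hT1 (inj T (fun A hA => ⟨hT2 A hA, by
      intro h
      apply hcL
      rw [← h]
      exact (mem_nd.1 (Finset.mem_of_mem_erase (hT1 A hA))).2⟩))
    rw [Finset.card_erase_of_mem (mem_nd.2 ⟨hBX, hBL⟩)] at this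
    omega
  · push Not at hB
    have hT : ∀ A ∈ nd X L, ∃ Q, Q ∈ nd (rm X L) M ∧ Q ∈ zeroSet (f A (i A)) := by
      intro A hA
      obtain ⟨hAX, hAL⟩ := mem_nd.1 hA
      have hF := (hf A hA).cover hAX
      have a1 : M ∉ lns (f A) := hF.not_mem hL hAX hAL hB
      obtain ⟨Q, hQ, hQr⟩ := tight_meet hM.1 (fun K hK => (hF.2.1 K hK).1) a1
        (S := nd (rm X L) M) (fun P hP => (mem_nd.1 hP).2)
        (fun P hP => hF.2.2 P (mem_rm.1 (mem_nd.1 hP).1).1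
          (by rintro rfl; exact (mem_rm.1 (mem_nd.1 hP).1).2 hAL))
        (by have := hF.1; omega) (hmem A)
      exact ⟨Q, hQ, hQr⟩
    choose! T hT1 hT2 using hT
    have := Finset.card_le_card_of_injOn T hT1 (inj T (fun A hA => ⟨hT2 A hA, by
      intro h
      apply hcM
      rw [← h]
      exact (mem_nd.1 (hT1 A hA)).2⟩))
    omega

/-- At least three maximal lines. -/
def K3 (n : ℕ) (X : Finset Pt) : Prop :=
  ∃ L M N : Set Pt, L ≠ M ∧ L ≠ N ∧ M ≠ N ∧ Mx n X L ∧ Mx n X M ∧ Mx n X N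

lemma exists_Mx {n : ℕ} (h : GM n) {X : Finset Pt} (hX : IsGC n X) : ∃ L, Mx n X L := by
  obtain ⟨l, h1, h2⟩ := h X hX
  refine ⟨zeroSet l, isLine_zeroSet h1, ?_⟩
  rw [← h2]
  apply le_of_eq
  congr 1

lemma k3_one {X : Finset Pt} (hX : IsGC 1 X) : K3 1 X := by
  have hc : X.card = 3 := by rw [hX.1.1]; rfl
  have h : ∀ A ∈ X, ∃ L, Mx 1 X L ∧ A ∉ L ∧ ∀ B ∈ X, B ≠ A → B ∈ L := by
    intro A hA
    obtain ⟨F, h1, h2, h3⟩ := hX.cover hA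
    have he : (X.erase A).card = 2 := by rw [Finset.card_erase_of_mem hA]; omega
    obtain ⟨B, hB⟩ := Finset.card_pos.1 (by omega : 0 < (X.erase A).card)
    obtain ⟨L, hL, hBL⟩ := h3 B (Finset.mem_of_mem_erase hB) (Finset.ne_of_mem_erase hB)
    have h4 : ∀ B ∈ X, B ≠ A → B ∈ L := by
      intro B' hB' hBA
      obtain ⟨L', hL', hBL'⟩ := h3 B' hB' hBA
      rw [Finset.card_le_one.1 h1 L hL L' hL']; exact hBL'
    refine ⟨L, ⟨(h2 L hL).1, ?_⟩, (h2 L hL).2.1, h4⟩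
    have : X.erase A ⊆ nd X L := by
      intro B' hB'
      exact mem_nd.2 ⟨Finset.mem_of_mem_erase hB', h4 B' (Finset.mem_of_mem_erase hB')
        (Finset.ne_of_mem_erase hB')⟩
    have := Finset.card_le_card this
    omega
  obtain ⟨A, B, c, hAB, hAC, hBC, rfl⟩ := Finset.card_eq_three.1 hc
  obtain ⟨L, a1, a2, a3⟩ := h A (by simp)
  obtain ⟨M, b1, b2, b3⟩ := h B (by simp)
  obtain ⟨N, c1, c2, c3⟩ := h c (by simp)
  refine ⟨L, M, N, ?_, ?_, ?_, a1, b1, c1⟩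
  · rintro rfl; exact a2 (b3 A (by simp) hAB)
  · rintro rfl; exact a2 (c3 A (by simp) hAC)
  · rintro rfl; exact b2 (c3 B (by simp) hBC)

lemma k3 {n : ℕ} (hGM : ∀ m ≤ n, GM m) : ∀ m, 1 ≤ m → m ≤ n → ∀ X, IsGC m X → K3 m X := by
  intro m hm
  induction m, hm using Nat.le_induction with
  | base => intro _ X hX; exact k3_one hX
  | succ m hm ih =>
    intro hmn X hX
    obtain ⟨L, hL⟩ := exists_Mx (hGM _ hmn) hX
    obtain ⟨N1, N2, N3, h12, h13, h23, m1, m2, m3⟩ := ih (by omega) _ (hX.rm hL)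
    have e1 := m1.ne_of_rm
    have e2 := m2.ne_of_rm
    have e3 := m3.ne_of_rm
    have k1 := key' hm hX hL m1 m2 m3 h12 h13 h23
    have k2 := key' hm hX hL m1 m3 m2 h13 h12 h23.symm
    have k3 := key' hm hX hL m2 m3 m1 h23 h12.symm h13.symm
    rcases k1 with k | k
    · rcases k3 with k' | k'
      · exact ⟨L, N1, N2, e1.symm, e2.symm, h12, hL, k, k'⟩
      · exact ⟨L, N1, N3, e1.symm, e3.symm, h13, hL, k, k'⟩
    · rcases k2 with k' | k'
      · exact ⟨L, N2, N1, e2.symm, e1.symm, h12.symm, hL, k, k'⟩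
      · exact ⟨L, N2, N3, e2.symm, e3.symm, h23, hL, k, k'⟩

/-- Key lemma with the third line supplied by `k3`. -/
lemma key {n : ℕ} (hGM : ∀ m ≤ n, GM m) {m : ℕ} (hm : 1 ≤ m) (hmn : m ≤ n) {X : Finset Pt}
    (hX : IsGC (m + 1) X) {L N N' : Set Pt} (hL : Mx (m + 1) X L) (hN : Mx m (rm X L) N)
    (hN' : Mx m (rm X L) N') (h12 : N ≠ N') : Mx (m + 1) X N ∨ Mx (m + 1) X N' := by
  obtain ⟨N1, N2, N3, h12, h13, h23, m1, m2, m3⟩ := k3 hGM m hm hmn _ (hX.rm hL)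
  by_cases a1 : N = N1 ∨ N' = N1
  · by_cases a2 : N = N2 ∨ N' = N2
    · have : N ≠ N3 ∧ N' ≠ N3 := by grind
      exact key' hm hX hL hN hN' m3 (by assumption) this.1 this.2
    · push Not at a2
      exact key' hm hX hL hN hN' m2 (by assumption) a2.1 a2.2
  · push Not at a1
    exact key' hm hX hL hN hN' m1 (by assumption) a1.1 a1.2


open MvPolynomial
open scoped Classical

set_option linter.unusedSimpArgs false
set_option linter.unusedVariables false

/-! ### Free nodes -/

/-- `B` is a node lying on `K` and on no other line of `Λ`. -/
def Free (X : Finset Pt) (Λ : Finset (Set Pt)) (K : Set Pt) (B : Pt) : Prop :=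
  B ∈ X ∧ B ∈ K ∧ ∀ M ∈ Λ, M ≠ K → B ∉ M

/-- The line `K` of `Λ` has a free node on `N`. -/
def Hit (X : Finset Pt) (Λ : Finset (Set Pt)) (K N : Set Pt) : Prop :=
  ∃ B, Free X Λ K B ∧ B ∈ N

lemma ext_lines {m : ℕ} {X : Finset Pt} {Λ I : Finset (Set Pt)} {N : Set Pt}
    (hN : Mx m (rem X Λ) N) (hI : I ⊆ Λ) (hh : ∀ K ∈ I, Hit X Λ K N) :
    Mx (m + I.card) (rem X (Λ \ I)) N := by
  refine ⟨hN.1, ?_⟩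
  choose! B hB hBN using hh
  have hinj : Set.InjOn B I := by
    intro K hK K' hK' he
    by_contra hne
    apply (hB K hK).2.2 K' (hI hK') (fun h => hne h.symm)
    rw [he]; exact (hB K' hK').2.1
  have hsub : nd (rem X Λ) N ∪ I.image B ⊆ nd (rem X (Λ \ I)) N := by
    apply Finset.union_subset
    · intro P hP
      obtain ⟨a, b⟩ := mem_nd.1 hP
      exact mem_nd.2 ⟨rem_subset_rem Finset.sdiff_subset a, b⟩
    · intro P hP
      obtain ⟨K, hK, rfl⟩ := Finset.mem_image.1 hP
      refine mem_nd.2 ⟨mem_rem.2 ⟨(hB K hK).1, ?_⟩, hBN K hK⟩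
      intro M hM
      obtain ⟨hM1, hM2⟩ := Finset.mem_sdiff.1 hM
      exact (hB K hK).2.2 M hM1 (by rintro rfl; exact hM2 hK)
  have hdis : Disjoint (nd (rem X Λ) N) (I.image B) := by
    rw [Finset.disjoint_right]
    intro P hP hP'
    obtain ⟨K, hK, rfl⟩ := Finset.mem_image.1 hP
    exact (mem_rem.1 (mem_nd.1 hP').1).2 K (hI hK) (hB K hK).2.1
  have := Finset.card_le_card hsub
  rw [Finset.card_union_of_disjoint hdis, Finset.card_image_of_injOn hinj] at this
  have := hN.2
  omega

lemma rem_erase {X : Finset Pt} {Λ : Finset (Set Pt)} {K : Set Pt} (hK : K ∈ Λ) :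
    rm (rem X (Λ.erase K)) K = rem X Λ := by
  rw [← rem_insert, Finset.insert_erase hK]

lemma rem_single (X : Finset Pt) (K : Set Pt) : rem X {K} = rm X K := by
  ext; simp [mem_rem, mem_rm]

lemma U1 {g : ℕ} (hGM : ∀ m ≤ g, GM m) {n m : ℕ} (hng : n ≤ g) {X : Finset Pt} (hX : IsGC n X)
    {Λ : Finset (Set Pt)} (hΛ : ∀ L ∈ Λ, Mx n X L) (hm : m + Λ.card = n) (hm1 : 1 ≤ m)
    {K N N' : Set Pt} (hK : K ∈ Λ) (hN : Mx m (rem X Λ) N) (hN' : Mx m (rem X Λ) N')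
    (hne : N ≠ N') : Hit X Λ K N ∨ Hit X Λ K N' := by
  have hc : 0 < Λ.card := Finset.card_pos.2 ⟨K, hK⟩
  obtain ⟨h1, h2⟩ := rem_gc hX (Λ.erase K) (m + 1)
    (fun L hL => hΛ L (Finset.mem_of_mem_erase hL))
    (by rw [Finset.card_erase_of_mem hK]; omega)
  have h3 := h2 K (hΛ K hK) (Finset.notMem_erase _ _)
  rw [← rem_erase hK] at hN hN'
  have fin : ∀ N, Mx (m + 1) (rem X (Λ.erase K)) N → Hit X Λ K N := by
    intro N hN
    obtain ⟨P, hP, hPK, hPN⟩ := G3 h1 h3 hN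
    obtain ⟨a, b⟩ := mem_rem.1 hP
    exact ⟨P, ⟨a, hPK, fun M hM hMK => b M (Finset.mem_erase.2 ⟨hMK, hM⟩)⟩, hPN⟩
  rcases key hGM hm1 (by omega) h1 h3 hN hN' hne with h | h
  · exact Or.inl (fin N h)
  · exact Or.inr (fin N' h)

lemma not_mem_of_rem {m : ℕ} {X : Finset Pt} {Λ : Finset (Set Pt)} {N : Set Pt}
    (hN : Mx m (rem X Λ) N) : N ∉ Λ := by
  intro h
  obtain ⟨A, hA, hAN⟩ := hN.nonempty
  exact (mem_rem.1 hA).2 N h hAN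

lemma exists_off {n : ℕ} {X : Finset Pt} {K : Set Pt} (hK : Mx n X K) (T : Finset (Set Pt))
    (hT : ∀ L ∈ T, IsLine L) (hKT : K ∉ T) (hc : T.card ≤ n) :
    ∃ B ∈ X, B ∈ K ∧ ∀ L ∈ T, B ∉ L := by
  by_contra hcon
  push Not at hcon
  have := cover_card hK.1 hT hKT (S := nd X K) (fun A hA => (mem_nd.1 hA).2)
    (fun A hA => hcon A (mem_nd.1 hA).1 (mem_nd.1 hA).2)
  have := hK.2
  omega

lemma resid {n m : ℕ} {X : Finset Pt} (hX : IsGC n X) {Λ : Finset (Set Pt)}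
    (hΛ : ∀ L ∈ Λ, Mx n X L) (hm : m + Λ.card = n) {K K' : Set Pt} (hK : K ∈ Λ) (hK' : K' ∈ Λ)
    (hne : K ≠ K') : ∃ c, ∃ G : Finset (Set Pt), c ∈ K ∧ c ∈ K' ∧ G.card ≤ m + 2 ∧
      (∀ L ∈ G, IsLine L ∧ c ∉ L ∧ Used n X L) ∧
      ∀ B ∈ X, (∀ M ∈ Λ, M ≠ K → M ≠ K' → B ∉ M) → B ≠ c → ∃ L ∈ G, B ∈ L := by
  have hc2 : 2 ≤ Λ.card := by
    rw [← Finset.card_pair hne]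
    apply Finset.card_le_card
    intro L hL
    simp only [Finset.mem_insert, Finset.mem_singleton] at hL
    rcases hL with rfl | rfl <;> assumption
  obtain ⟨c, hc, hcK, hcK'⟩ := G3 hX (hΛ K hK) (hΛ K' hK')
  obtain ⟨F, hF⟩ := hX.cover hc
  refine ⟨c, F \ ((Λ.erase K).erase K'), hcK, hcK', ?_, ?_, ?_⟩
  · have hsub : (Λ.erase K).erase K' ⊆ F := by
      intro M hM
      obtain ⟨h1, hM⟩ := Finset.mem_erase.1 hM
      obtain ⟨h2, hM⟩ := Finset.mem_erase.1 hM
      exact hF.mem (hΛ M hM) (fun h => G4 (by omega) hX (hΛ K hK) (hΛ K' hK') (hΛ M hM) hne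
        h2.symm h1.symm hcK hcK' h)
    rw [Finset.card_sdiff_of_subset hsub,
      Finset.card_erase_of_mem (Finset.mem_erase.2 ⟨hne.symm, hK'⟩), Finset.card_erase_of_mem hK]
    have := hF.1
    omega
  · intro L hL
    exact hF.2.1 L (Finset.mem_sdiff.1 hL).1
  · intro B hB hBM hBc
    obtain ⟨L, hL, hBL⟩ := hF.2.2 B hB hBc
    refine ⟨L, Finset.mem_sdiff.2 ⟨hL, ?_⟩, hBL⟩
    intro h
    obtain ⟨h1, hM⟩ := Finset.mem_erase.1 h
    obtain ⟨h2, hM⟩ := Finset.mem_erase.1 hM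
    exact hBM L hM h2 h1 hBL

lemma Free.ne {X : Finset Pt} {Λ : Finset (Set Pt)} {K K' : Set Pt} {B c : Pt}
    (h : Free X Λ K B) (hK' : K' ∈ Λ) (hne : K ≠ K') (hc : c ∈ K') : B ≠ c := by
  rintro rfl
  exact h.2.2 K' hK' hne.symm hc

lemma Free.ne_free {X : Finset Pt} {Λ : Finset (Set Pt)} {K K' : Set Pt} {B B' : Pt}
    (h : Free X Λ K B) (hK' : K' ∈ Λ) (hne : K ≠ K') (h' : Free X Λ K' B') : B ≠ B' :=
  h.ne hK' hne h'.2.1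

lemma mem_of_four {G : Finset (Set Pt)} (hG : ∀ L ∈ G, IsLine L) (hc : G.card ≤ 3) {N : Set Pt}
    {m : ℕ} {X : Finset Pt} {Λ : Finset (Set Pt)} (hN : Mx 1 (rem X Λ) N) {K K' : Set Pt}
    (hK : K ∈ Λ) (hK' : K' ∈ Λ) (hne : K ≠ K') (h1 : Hit X Λ K N) (h2 : Hit X Λ K' N)
    {c : Pt} (hcK : c ∈ K) (hcK' : c ∈ K')
    (hcov : ∀ B ∈ X, (∀ M ∈ Λ, M ≠ K → M ≠ K' → B ∉ M) → B ≠ c → ∃ L ∈ G, B ∈ L) : N ∈ G := by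
  obtain ⟨B, hB, hBN⟩ := h1
  obtain ⟨B', hB', hBN'⟩ := h2
  have hBB : B ≠ B' := hB.ne_free hK' hne hB'
  have n1 : B' ∉ nd (rem X Λ) N := fun h => (mem_rem.1 (mem_nd.1 h).1).2 K' hK' hB'.2.1
  have n2 : B ∉ insert B' (nd (rem X Λ) N) := by
    rw [Finset.mem_insert, not_or]
    exact ⟨hBB, fun h => (mem_rem.1 (mem_nd.1 h).1).2 K hK hB.2.1⟩
  refine mem_of_many hN.1 hG (S := insert B (insert B' (nd (rem X Λ) N))) ?_ ?_ ?_
  · intro A hA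
    simp only [Finset.mem_insert] at hA
    rcases hA with rfl | rfl | hA
    · exact hBN
    · exact hBN'
    · exact (mem_nd.1 hA).2
  · intro A hA
    simp only [Finset.mem_insert] at hA
    rcases hA with rfl | rfl | hA
    · exact hcov A hB.1 (fun M hM h1 _ => hB.2.2 M hM h1) (hB.ne hK' hne hcK')
    · exact hcov A hB'.1 (fun M hM _ h1 => hB'.2.2 M hM h1) (hB'.ne hK hne.symm hcK)
    · have := mem_rem.1 (mem_nd.1 hA).1
      exact hcov A this.1 (fun M hM _ _ => this.2 M hM)
        (by rintro rfl; exact this.2 K hK hcK)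
  · rw [Finset.card_insert_of_notMem n2, Finset.card_insert_of_notMem n1]
    have := hN.2
    omega

lemma L3a {n : ℕ} {X : Finset Pt} (hX : IsGC n X)
    {Λ : Finset (Set Pt)} (hΛ : ∀ L ∈ Λ, Mx n X L) (hm : 1 + Λ.card = n)
    {K K' N N' : Set Pt} (hK : K ∈ Λ) (hK' : K' ∈ Λ) (hne : K ≠ K')
    (hN : Mx 1 (rem X Λ) N) (hN' : Mx 1 (rem X Λ) N') (hNN : N ≠ N')
    (h1 : Hit X Λ K N) (h2 : Hit X Λ K' N) (h3 : Hit X Λ K N') (h4 : Hit X Λ K' N')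
    {B B' : Pt} (hB : Free X Λ K B) (hB' : Free X Λ K' B') (b1 : B ∉ N) (b2 : B ∉ N')
    (b3 : B' ∉ N) (b4 : B' ∉ N') : ∃ r, IsLine r ∧ Used n X r ∧ B ∈ r ∧ B' ∈ r := by
  obtain ⟨c, G, hcK, hcK', hG1, hG2, hcov⟩ := resid hX hΛ hm hK hK' hne
  have m1 : N ∈ G := mem_of_four (m := 0) (fun L hL => (hG2 L hL).1) hG1 hN hK hK' hne h1 h2
    hcK hcK' hcov
  have m2 : N' ∈ G := mem_of_four (m := 0) (fun L hL => (hG2 L hL).1) hG1 hN' hK hK' hne h3 h4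
    hcK hcK' hcov
  obtain ⟨r, hr, hBr⟩ := hcov B hB.1 (fun M hM h1 _ => hB.2.2 M hM h1) (hB.ne hK' hne hcK')
  obtain ⟨r', hr', hBr'⟩ := hcov B' hB'.1 (fun M hM _ h1 => hB'.2.2 M hM h1)
    (hB'.ne hK hne.symm hcK)
  have hcard : ((G.erase N).erase N').card ≤ 1 := by
    rw [Finset.card_erase_of_mem (Finset.mem_erase.2 ⟨hNN.symm, m2⟩), Finset.card_erase_of_mem m1]
    omega
  have e : r = r' := Finset.card_le_one.1 hcard r
    (Finset.mem_erase.2 ⟨by rintro rfl; exact b2 hBr, Finset.mem_erase.2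
      ⟨by rintro rfl; exact b1 hBr, hr⟩⟩) r'
    (Finset.mem_erase.2 ⟨by rintro rfl; exact b4 hBr', Finset.mem_erase.2
      ⟨by rintro rfl; exact b3 hBr', hr'⟩⟩)
  subst e
  exact ⟨r, (hG2 r hr).1, (hG2 r hr).2.2, hBr, hBr'⟩

lemma L3b {n : ℕ} {X : Finset Pt} (hX : IsGC n X)
    {Λ : Finset (Set Pt)} (hΛ : ∀ L ∈ Λ, Mx n X L) (hm : 1 + Λ.card = n)
    {K K' N N' M : Set Pt} (hK : K ∈ Λ) (hK' : K' ∈ Λ) (hne : K ≠ K')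
    (hN : Mx 1 (rem X Λ) N) (hN' : Mx 1 (rem X Λ) N') (hM : Mx 1 (rem X Λ) M) (hNN : N ≠ N')
    (hNM : N ≠ M) (hNM' : N' ≠ M)
    (h1 : Hit X Λ K M) (h2 : Hit X Λ K' M) (h3 : Hit X Λ K N') (h4 : Hit X Λ K' N)
    {B B' O : Pt} (hB : Free X Λ K B) (hB' : Free X Λ K' B') (b1 : B ∉ N) (b2 : B ∉ N')
    (b3 : B ∉ M) (b1' : B' ∉ N) (b2' : B' ∉ N') (b3' : B' ∉ M) (hO : O ∈ N) (hO' : O ∈ N') :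
    ∃ r, IsLine r ∧ Used n X r ∧ B ∈ r ∧ B' ∈ r ∧ O ∈ r := by
  have hR := (rem_gc hX Λ 1 hΛ hm).1
  obtain ⟨c, G, hcK, hcK', hG1, hG2, hcov⟩ := resid hX hΛ hm hK hK' hne
  have m1 : M ∈ G := mem_of_four (m := 0) (fun L hL => (hG2 L hL).1) hG1 hM hK hK' hne h1 h2
    hcK hcK' hcov
  have hOR : O ∈ rem X Λ := by
    obtain ⟨P, hP, hPN, hPN'⟩ := G3 hR hN hN'
    rwa [meet_unique hN.1 hN'.1 hNN hO hO' hPN hPN']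
  have hOM : O ∉ M := fun h => G4 le_rfl hR hN hN' hM hNN hNM hNM' hO hO' h
  have inR : ∀ {N N' : Set Pt} {P : Pt}, Mx 1 (rem X Λ) N → Mx 1 (rem X Λ) N' → N ≠ N' →
      P ∈ N → P ∈ N' → ∀ {L}, L ∈ Λ → P ∉ L := by
    intro N N' P hN hN' hNN h1 h2 L hL
    obtain ⟨Q, hQ, hQN, hQN'⟩ := G3 hR hN hN'
    rw [meet_unique hN.1 hN'.1 hNN h1 h2 hQN hQN']
    exact (mem_rem.1 hQ).2 L hL
  obtain ⟨H, hH, hHN⟩ := h3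
  obtain ⟨H', hH', hHN'⟩ := h4
  have hHM : H ∉ M := fun h => inR hN' hM hNM' hHN h hK hH.2.1
  have hHM' : H' ∉ M := fun h => inR hN hM hNM hHN' h hK' hH'.2.1
  have cv : ∀ {P}, Free X Λ K P → P ∉ M → ∃ L ∈ G.erase M, P ∈ L := by
    intro P hP hPM
    obtain ⟨L, hL, hPL⟩ := hcov P hP.1 (fun M hM h1 _ => hP.2.2 M hM h1) (hP.ne hK' hne hcK')
    exact ⟨L, Finset.mem_erase.2 ⟨by rintro rfl; exact hPM hPL, hL⟩, hPL⟩
  have cv' : ∀ {P}, Free X Λ K' P → P ∉ M → ∃ L ∈ G.erase M, P ∈ L := by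
    intro P hP hPM
    obtain ⟨L, hL, hPL⟩ := hcov P hP.1 (fun M hM _ h1 => hP.2.2 M hM h1) (hP.ne hK hne.symm hcK)
    exact ⟨L, Finset.mem_erase.2 ⟨by rintro rfl; exact hPM hPL, hL⟩, hPL⟩
  obtain ⟨r, hr, hOr⟩ : ∃ L ∈ G.erase M, O ∈ L := by
    obtain ⟨a, b⟩ := mem_rem.1 hOR
    obtain ⟨L, hL, hPL⟩ := hcov O a (fun M hM _ _ => b M hM) (by rintro rfl; exact b K hK hcK)
    exact ⟨L, Finset.mem_erase.2 ⟨by rintro rfl; exact hOM hPL, hL⟩, hPL⟩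
  have hcard : (G.erase M).card ≤ 2 := by
    rw [Finset.card_erase_of_mem m1]; omega
  have lin : ∀ L ∈ G.erase M, IsLine L := fun L hL => (hG2 L (Finset.mem_of_mem_erase hL)).1
  have cn : ∀ L ∈ G.erase M, c ∉ L := fun L hL => (hG2 L (Finset.mem_of_mem_erase hL)).2.1
  have two : ∀ {L L'}, L ∈ G.erase M → L' ∈ G.erase M → L ≠ r → L' ≠ r → L = L' := by
    intro L L' hL hL' h h'
    have : ((G.erase M).erase r).card ≤ 1 := by
      rw [Finset.card_erase_of_mem hr]; omega
    exact Finset.card_le_one.1 this L (Finset.mem_erase.2 ⟨h, hL⟩) L' (Finset.mem_erase.2 ⟨h', hL'⟩)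
  have noK : ∀ {P Q L}, P ≠ Q → L ∈ G.erase M → P ∈ K → Q ∈ K → P ∈ L → Q ∈ L → False := by
    intro P Q L hPQ hL h1 h2 h3 h4
    apply cn L hL
    rw [line_unique (lin L hL) (hΛ K hK).1 hPQ h3 h4 h1 h2]
    exact hcK
  have noK' : ∀ {P Q L}, P ≠ Q → L ∈ G.erase M → P ∈ K' → Q ∈ K' → P ∈ L → Q ∈ L → False := by
    intro P Q L hPQ hL h1 h2 h3 h4
    apply cn L hL
    rw [line_unique (lin L hL) (hΛ K' hK').1 hPQ h3 h4 h1 h2]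
    exact hcK'
  have hHB : H ≠ B := by rintro rfl; exact b2 hHN
  have hHB' : H' ≠ B' := by rintro rfl; exact b1' hHN'
  have hHO : H ≠ O := by rintro rfl; exact (mem_rem.1 hOR).2 K hK hH.2.1
  have hHO' : H' ≠ O := by rintro rfl; exact (mem_rem.1 hOR).2 K' hK' hH'.2.1
  obtain ⟨s, hs, hHs⟩ := cv hH hHM
  obtain ⟨s', hs', hHs'⟩ := cv' hH' hHM'
  obtain ⟨t, ht, hBt⟩ := cv hB b3
  obtain ⟨t', ht', hBt'⟩ := cv' hB' b3'
  -- s ≠ r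
  have hsr : s ≠ r := by
    rintro rfl
    have e : s = N' := line_unique (lin s hs) hN'.1 hHO hHs hOr hHN hO'
    have t1 : t' ≠ s := by rintro rfl; rw [e] at hBt'; exact b2' hBt'
    have t2 : s' ≠ s := by
      rintro rfl; rw [e] at hHs'; exact hHO' (meet_unique hN.1 hN'.1 hNN hHN' hHs' hO hO')
    have := two ht' hs' t1 t2
    subst this
    exact noK' hHB' hs' hH'.2.1 hB'.2.1 hHs' hBt'
  have hsr' : s' ≠ r := by
    rintro rfl
    have e : s' = N := line_unique (lin s' hs') hN.1 hHO' hHs' hOr hHN' hO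
    have t1 : t ≠ s' := by rintro rfl; rw [e] at hBt; exact b1 hBt
    have := two ht hs t1 hsr
    subst this
    exact noK hHB hs hH.2.1 hB.2.1 hHs hBt
  have e := two hs hs' hsr hsr'
  subst e
  have e1 : t = r := by
    by_contra h
    have := two ht hs h hsr
    subst this
    exact noK hHB ht hH.2.1 hB.2.1 hHs hBt
  have e2 : t' = r := by
    by_contra h
    have := two ht' hs h hsr
    subst this
    exact noK' hHB' ht' hH'.2.1 hB'.2.1 hHs' hBt'
  subst e1
  subst e2
  exact ⟨_, lin _ ht, (hG2 _ (Finset.mem_of_mem_erase ht)).2.2, hBt, hBt', hOr⟩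

/-- A free node off the three sides. -/
lemma exists_free_off {n : ℕ} {X : Finset Pt} (hX : IsGC n X)
    {Λ : Finset (Set Pt)} (hΛ : ∀ L ∈ Λ, Mx n X L) (hm : 1 + Λ.card = n) {K N N' M : Set Pt}
    (hK : K ∈ Λ) (hN : ¬ Hit X Λ K N) (hN' : Mx 1 (rem X Λ) N') (hM : Mx 1 (rem X Λ) M) :
    ∃ B, Free X Λ K B ∧ B ∉ N ∧ B ∉ N' ∧ B ∉ M := by
  obtain ⟨B, hB, hBK, h⟩ := exists_off (hΛ K hK) (insert N' (insert M (Λ.erase K))) (by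
      intro L hL
      simp only [Finset.mem_insert] at hL
      rcases hL with rfl | rfl | hL
      · exact hN'.1
      · exact hM.1
      · exact (hΛ L (Finset.mem_of_mem_erase hL)).1) (by
      simp only [Finset.mem_insert, not_or]
      refine ⟨?_, ?_, Finset.notMem_erase _ _⟩
      · rintro rfl; exact not_mem_of_rem hN' hK
      · rintro rfl; exact not_mem_of_rem hM hK) (by
      have h1 := Finset.card_insert_le N' (insert M (Λ.erase K))
      have h2 := Finset.card_insert_le M (Λ.erase K)
      rw [Finset.card_erase_of_mem hK] at h2
      have := Finset.card_pos.2 ⟨K, hK⟩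
      omega)
  have hf : Free X Λ K B := ⟨hB, hBK, fun M hM hMK => h M (by simp [hM, hMK])⟩
  exact ⟨B, hf, fun h => hN ⟨B, hf, h⟩, h N' (by simp), h M (by simp)⟩

lemma L3' {g : ℕ} (hGM : ∀ m ≤ g, GM m) {n : ℕ} (hng : n ≤ g) {X : Finset Pt} (hX : IsGC n X)
    {Λ : Finset (Set Pt)} (hΛ : ∀ L ∈ Λ, Mx n X L) (hm : 1 + Λ.card = n)
    {N1 N2 N3 a1 b a2 a3 : Set Pt} (m1 : Mx 1 (rem X Λ) N1) (m2 : Mx 1 (rem X Λ) N2)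
    (m3 : Mx 1 (rem X Λ) N3) (h12 : N1 ≠ N2) (h13 : N1 ≠ N3) (h23 : N2 ≠ N3)
    (k1 : a1 ∈ Λ) (kb : b ∈ Λ) (k2 : a2 ∈ Λ) (k3 : a3 ∈ Λ) (hne : a1 ≠ b)
    (x1 : ¬ Hit X Λ a1 N1) (xb : ¬ Hit X Λ b N1) (x2 : ¬ Hit X Λ a2 N2) (x3 : ¬ Hit X Λ a3 N3) :
    False := by
  have u : ∀ {K N N'}, K ∈ Λ → Mx 1 (rem X Λ) N → Mx 1 (rem X Λ) N' → N ≠ N' →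
      ¬ Hit X Λ K N → Hit X Λ K N' := fun hK hN hN' hne hh =>
    (U1 hGM hng hX hΛ hm le_rfl hK hN hN' hne).resolve_left hh
  obtain ⟨F1, f1, p1, p2, p3⟩ := exists_free_off hX hΛ hm k1 x1 m2 m3
  obtain ⟨Fb, fb, q1, q2, q3⟩ := exists_free_off hX hΛ hm kb xb m2 m3
  obtain ⟨F2, f2, r2, r1, r3⟩ := exists_free_off hX hΛ hm k2 x2 m1 m3
  obtain ⟨F3, f3, s3, s1, s2⟩ := exists_free_off hX hΛ hm k3 x3 m1 m2
  have hR := (rem_gc hX Λ 1 hΛ hm).1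
  obtain ⟨O2, o1, o2, o3⟩ := G3 hR m1 m2
  obtain ⟨O3, o1', o2', o3'⟩ := G3 hR m1 m3
  have e12 : a1 ≠ a2 := by rintro rfl; exact x2 (u k1 m1 m2 h12 x1)
  have eb2 : b ≠ a2 := by rintro rfl; exact x2 (u kb m1 m2 h12 xb)
  have e13 : a1 ≠ a3 := by rintro rfl; exact x3 (u k1 m1 m3 h13 x1)
  have eb3 : b ≠ a3 := by rintro rfl; exact x3 (u kb m1 m3 h13 xb)
  obtain ⟨r, lr, -, c1, c2, c3⟩ := L3b hX hΛ hm k1 k2 e12 m1 m2 m3 h12 h13 h23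
    (u k1 m1 m3 h13 x1) (u k2 m2 m3 h23 x2) (u k1 m1 m2 h12 x1) (u k2 m2 m1 h12.symm x2) f1 f2
    p1 p2 p3 r1 r2 r3 o2 o3
  obtain ⟨r', lr', -, c1', c2', c3'⟩ := L3b hX hΛ hm kb k2 eb2 m1 m2 m3 h12 h13 h23
    (u kb m1 m3 h13 xb) (u k2 m2 m3 h23 x2) (u kb m1 m2 h12 xb) (u k2 m2 m1 h12.symm x2) fb f2
    q1 q2 q3 r1 r2 r3 o2 o3
  have F2O : F2 ≠ O2 := by rintro rfl; exact r1 o2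
  have er := line_unique lr lr' F2O c2 c3 c2' c3'
  subst er
  obtain ⟨t, lt, -, d1, d2, d3⟩ := L3b hX hΛ hm k1 k3 e13 m1 m3 m2 h13 h12 h23.symm
    (u k1 m1 m2 h12 x1) (u k3 m3 m2 h23.symm x3) (u k1 m1 m3 h13 x1) (u k3 m3 m1 h13.symm x3) f1 f3
    p1 p3 p2 s1 s3 s2 o2' o3'
  obtain ⟨t', lt', -, d1', d2', d3'⟩ := L3b hX hΛ hm kb k3 eb3 m1 m3 m2 h13 h12 h23.symm
    (u kb m1 m2 h12 xb) (u k3 m3 m2 h23.symm x3) (u kb m1 m3 h13 xb) (u k3 m3 m1 h13.symm x3) fb f3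
    q1 q3 q2 s1 s3 s2 o2' o3'
  have F3O : F3 ≠ O3 := by rintro rfl; exact s1 o2'
  have et := line_unique lt lt' F3O d2 d3 d2' d3'
  subst et
  have e := line_unique lr lt (f1.ne_free kb hne fb) c1 c1' d1 d1'
  subst e
  have OO : O2 ≠ O3 := by
    rintro rfl
    exact G4 le_rfl hR m1 m2 m3 h12 h13 h23 o2 o3 o3'
  have := line_unique lr m1.1 OO c3 d3 o2 o2'
  rw [this] at c1
  exact p1 c1


open MvPolynomial
open scoped Classical

set_option linter.unusedSimpArgs false
set_option linter.unusedVariables false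

/-! ### The algebraic configuration lemma -/

lemma totalDegree_form (a b c : ℝ) (h : a ≠ 0 ∨ b ≠ 0) :
    (C a * X 0 + C b * X 1 + C c : Poly2).totalDegree = 1 := by
  have hle : (C a * X 0 + C b * X 1 + C c : Poly2).totalDegree ≤ 1 := by
    refine (totalDegree_add _ _).trans (max_le ((totalDegree_add _ _).trans (max_le ?_ ?_)) ?_)
    · refine (totalDegree_mul _ _).trans ?_
      simp
    · refine (totalDegree_mul _ _).trans ?_
      simp
    · simp
  have hne : (C a * X 0 + C b * X 1 + C c : Poly2).totalDegree ≠ 0 := by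
    intro h0
    rw [totalDegree_eq_zero_iff_eq_C] at h0
    set k := coeff 0 (C a * X 0 + C b * X 1 + C c : Poly2)
    have e : ∀ P : ℝ × ℝ, a * P.1 + b * P.2 + c = k := by
      intro P
      rw [← evalPt_form, h0, evalPt_C]
    have e0 := e (0, 0)
    have e1 := e (1, 0)
    have e2 := e (0, 1)
    simp at e0 e1 e2
    rcases h with h | h
    · apply h; linarith
    · apply h; linarith
  omega

lemma isLine_form (a b c : ℝ) (h : a ≠ 0 ∨ b ≠ 0) :
    IsLine {P : Pt | a * P.1 + b * P.2 + c = 0} := by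
  refine ⟨_, totalDegree_form a b c h, ?_⟩
  ext P
  rw [mem_zeroSet, evalPt_form]
  rfl

lemma lin_form {N : Set Pt} (hN : IsLine N) {F : Pt} (hF : F ∉ N) :
    ∃ a b c : ℝ, (∀ P : Pt, P ∈ N ↔ a * P.1 + b * P.2 + c = 0) ∧ a * F.1 + b * F.2 + c = 1 := by
  obtain ⟨l, hl, rfl⟩ := hN
  obtain ⟨a, b, c, -, rfl⟩ := deg1_form l hl
  rw [mem_zeroSet, evalPt_form] at hF
  set d := a * F.1 + b * F.2 + c with hd
  refine ⟨a / d, b / d, c / d, ?_, ?_⟩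
  · intro P
    rw [mem_zeroSet, evalPt_form]
    have : a / d * P.1 + b / d * P.2 + c / d = (a * P.1 + b * P.2 + c) / d := by ring
    rw [this, div_eq_zero_iff]
    tauto
  · have : a / d * F.1 + b / d * F.2 + c / d = (a * F.1 + b * F.2 + c) / d := by ring
    rw [this, ← hd, div_self hF]

lemma pair_alg {F F' O : Pt} (hne : F ≠ F') {r : Set Pt} (hr : IsLine r) (h1 : F ∈ r) (h2 : F' ∈ r)
    (h3 : O ∈ r) {a b c a' b' c' : ℝ} (e1 : a * F.1 + b * F.2 + c = 1)
    (e2 : a' * F'.1 + b' * F'.2 + c' = 1) (o1 : a * O.1 + b * O.2 + c = 0)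
    (o2 : a' * O.1 + b' * O.2 + c' = 0) :
    (a * F'.1 + b * F'.2 + c) * (a' * F.1 + b' * F.2 + c') = 1 := by
  obtain ⟨l, hl, rfl⟩ := hr
  obtain ⟨u, v, w, huv, rfl⟩ := deg1_form l hl
  rw [mem_zeroSet, evalPt_form] at h1 h2 h3
  have k1 : u * (F'.1 - F.1) + v * (F'.2 - F.2) = 0 := by linear_combination h2 - h1
  have k2 : u * (O.1 - F.1) + v * (O.2 - F.2) = 0 := by linear_combination h3 - h1
  have det : (F'.1 - F.1) * (O.2 - F.2) = (F'.2 - F.2) * (O.1 - F.1) := by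
    rcases huv with h | h
    · apply mul_left_cancel₀ h; linear_combination (O.2 - F.2) * k1 - (F'.2 - F.2) * k2
    · apply mul_left_cancel₀ h; linear_combination (F'.1 - F.1) * k2 - (O.1 - F.1) * k1
  have : ∃ t : ℝ, O.1 - F.1 = t * (F'.1 - F.1) ∧ O.2 - F.2 = t * (F'.2 - F.2) := by
    by_cases h : F'.1 - F.1 = 0
    · have h' : F'.2 - F.2 ≠ 0 := by
        intro h'
        exact hne (Prod.ext (by linarith) (by linarith))
      refine ⟨(O.2 - F.2) / (F'.2 - F.2), ?_, by field_simp⟩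
      rw [h, zero_mul] at det
      rw [h, mul_zero]
      exact (mul_eq_zero.1 det.symm).resolve_left h'
    · refine ⟨(O.1 - F.1) / (F'.1 - F.1), by field_simp, ?_⟩
      field_simp
      linarith
  obtain ⟨t, t1, t2⟩ := this
  set p := a * F'.1 + b * F'.2 + c with hp
  set q := a' * F.1 + b' * F.2 + c' with hq
  have g1 : (1 - t) + t * p = 0 := by rw [hp]; linear_combination o1 - a * t1 - b * t2 - (1 - t) * e1
  have g2 : (1 - t) * q + t = 0 := by
    rw [hq]; linear_combination o2 - a' * t1 - b' * t2 - t * e2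
  have ht : t ≠ 0 := by rintro rfl; norm_num at g1
  have ht' : 1 - t ≠ 0 := by
    intro h; rw [h] at g2; simp at g2; exact ht g2
  apply mul_left_cancel₀ (mul_ne_zero ht ht')
  linear_combination (1 - t) * q * g1 - (1 - t) * g2

lemma tri_alg {ν1 ν2 ν3 : Set Pt} {F1 F2 F3 O12 O13 O23 : Pt} (l1 : IsLine ν1)
    (f11 : F1 ∉ ν1) (n12 : F1 ≠ F2) (n13 : F1 ≠ F3)
    {r12 r13 : Set Pt} (lr12 : IsLine r12) (lr13 : IsLine r13)
    (a1 : F1 ∈ r12) (a2 : F2 ∈ r12) (a3 : O12 ∈ r12)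
    (b1 : F1 ∈ r13) (b2 : F3 ∈ r13) (b3 : O13 ∈ r13)
    (o12 : O12 ∈ ν1) (o13 : O13 ∈ ν1) (o23 : O23 ∈ ν2) (o23n : O23 ∉ ν1) (oo : O12 ≠ O13)
    {a b c a' b' c' k : ℝ} (hν1 : ∀ P : Pt, P ∈ ν1 ↔ a * P.1 + b * P.2 + c = 0)
    (hν2 : ∀ P : Pt, P ∈ ν2 ↔ a' * P.1 + b' * P.2 + c' = 0)
    (e1 : a * F1.1 + b * F1.2 + c = k * (a' * F1.1 + b' * F1.2 + c'))
    (e2 : a * F2.1 + b * F2.2 + c = k * (a' * F2.1 + b' * F2.2 + c'))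
    (e3 : a * F3.1 + b * F3.2 + c = k * (a' * F3.1 + b' * F3.2 + c')) : False := by
  by_cases h : a - k * a' ≠ 0 ∨ b - k * b' ≠ 0
  · have hs := isLine_form (a - k * a') (b - k * b') (c - k * c') h
    set s := {P : Pt | (a - k * a') * P.1 + (b - k * b') * P.2 + (c - k * c') = 0} with hsdef
    have s1 : F1 ∈ s := by show _ = _; linear_combination e1
    have s2 : F2 ∈ s := by show _ = _; linear_combination e2
    have s3 : F3 ∈ s := by show _ = _; linear_combination e3
    have q1 := line_unique lr12 hs n12 a1 a2 s1 s2
    have q2 := line_unique lr13 hs n13 b1 b2 s1 s3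
    rw [q1] at a3
    rw [q2] at b3
    have := line_unique hs l1 oo a3 b3 o12 o13
    rw [this] at s1
    exact f11 s1
  · push Not at h
    have hc : c - k * c' = 0 := by linear_combination e1 - h.1 * F1.1 - h.2 * F1.2
    apply o23n
    rw [hν1]
    have := (hν2 O23).1 o23
    linear_combination k * this + h.1 * O23.1 + h.2 * O23.2 + hc

lemma det_factor (p q r x y z P Q R X Y Z : ℝ) (hp : p * P = 1) (hq : q * Q = 1) (hr : r * R = 1)
    (hx : x * X = 1) (hy : y * Y = 1) (hz : z * Z = 1)
    (hdet : Matrix.det !![1, p, q, r; P, 1, x, y; Q, X, 1, z; R, Y, Z, 1] = 0) :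
    p * x = q ∨ p * y = r ∨ q * z = r ∨ x * z = y := by
  have hp0 : p ≠ 0 := left_ne_zero_of_mul_eq_one hp
  have hq0 : q ≠ 0 := left_ne_zero_of_mul_eq_one hq
  have hr0 : r ≠ 0 := left_ne_zero_of_mul_eq_one hr
  have hx0 : x ≠ 0 := left_ne_zero_of_mul_eq_one hx
  have hy0 : y ≠ 0 := left_ne_zero_of_mul_eq_one hy
  have hz0 : z ≠ 0 := left_ne_zero_of_mul_eq_one hz
  obtain rfl : P = p⁻¹ := eq_inv_of_mul_eq_one_right hp
  obtain rfl : Q = q⁻¹ := eq_inv_of_mul_eq_one_right hq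
  obtain rfl : R = r⁻¹ := eq_inv_of_mul_eq_one_right hr
  obtain rfl : X = x⁻¹ := eq_inv_of_mul_eq_one_right hx
  obtain rfl : Y = y⁻¹ := eq_inv_of_mul_eq_one_right hy
  obtain rfl : Z = z⁻¹ := eq_inv_of_mul_eq_one_right hz
  rw [Matrix.det_succ_row_zero] at hdet
  simp [Fin.sum_univ_succ, Matrix.det_fin_three, Fin.succAbove] at hdet
  have key : (p * x - q) * (p * y - r) * (q * z - r) * (x * z - y) = 0 := by
    field_simp at hdet
    linear_combination -hdet
  rcases mul_eq_zero.1 key with h | h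
  · rcases mul_eq_zero.1 h with h | h
    · rcases mul_eq_zero.1 h with h | h
      · left; linarith
      · right; left; linarith
    · right; right; left; linarith
  · right; right; right; linarith

lemma E_alg (ν : Fin 4 → Set Pt) (F : Fin 4 → Pt) (l : ∀ i, IsLine (ν i)) (f : ∀ i, F i ∉ ν i)
    (n : ∀ i j, i ≠ j → F i ≠ F j)
    (h : ∀ i j, i ≠ j → ∃ O r, IsLine r ∧ F i ∈ r ∧ F j ∈ r ∧ O ∈ r ∧ O ∈ ν i ∧ O ∈ ν j)
    (conc : ∀ i j k, i ≠ j → i ≠ k → j ≠ k → ∀ O, O ∈ ν i → O ∈ ν j → O ∉ ν k) : False := by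
  choose a b c hν hF using fun i => lin_form (l i) (f i)
  set v : Fin 4 → Fin 4 → ℝ := fun i j => a i * (F j).1 + b i * (F j).2 + c i with hv
  have hvv : ∀ i j, i ≠ j → v i j * v j i = 1 := by
    intro i j hij
    obtain ⟨O, r, hr, h1, h2, h3, h4, h5⟩ := h i j hij
    exact pair_alg (n i j hij) hr h1 h2 h3 (hF i) (hF j) ((hν i O).1 h4) ((hν j O).1 h5)
  have hdet : Matrix.det !![v 0 0, v 0 1, v 0 2, v 0 3; v 1 0, v 1 1, v 1 2, v 1 3;
      v 2 0, v 2 1, v 2 2, v 2 3; v 3 0, v 3 1, v 3 2, v 3 3] = 0 := by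
    rw [Matrix.det_succ_row_zero]
    simp [Fin.sum_univ_succ, Matrix.det_fin_three, Fin.succAbove]
    simp only [hv]
    ring
  have tri : ∀ i j k, i ≠ j → i ≠ k → j ≠ k → v i j * v j k = v i k → False := by
    intro i j k hij hik hjk he
    obtain ⟨O12, r12, lr12, p1, p2, p3, p4, p5⟩ := h i j hij
    obtain ⟨O13, r13, lr13, q1, q2, q3, q4, q5⟩ := h i k hik
    obtain ⟨O23, r23, lr23, s1, s2, s3, s4, s5⟩ := h j k hjk
    refine tri_alg (k := v i j) (l i) (f i) (n i j hij) (n i k hik) lr12 lr13 p1 p2 p3 q1 q2 q3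
      p4 q4 s4 (ν3 := ν k) (fun hh => conc i j k hij hik hjk O23 hh s4 s5) ?_ (hν i) (hν j) ?_ ?_ ?_
    · rintro rfl; exact conc i j k hij hik hjk O12 p4 p5 q5
    · rw [hF i]; exact (hvv i j hij).symm
    · rw [hF j, mul_one]
    · exact he.symm
  have d : ∀ i, v i i = 1 := hF
  rw [d 0, d 1, d 2, d 3] at hdet
  rcases det_factor _ _ _ _ _ _ _ _ _ _ _ _ (hvv 0 1 (by decide)) (hvv 0 2 (by decide))
    (hvv 0 3 (by decide)) (hvv 1 2 (by decide)) (hvv 1 3 (by decide)) (hvv 2 3 (by decide)) hdet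
    with h | h | h | h
  · exact tri 0 1 2 (by decide) (by decide) (by decide) h
  · exact tri 0 1 3 (by decide) (by decide) (by decide) h
  · exact tri 0 2 3 (by decide) (by decide) (by decide) h
  · exact tri 1 2 3 (by decide) (by decide) (by decide) h


open MvPolynomial
open scoped Classical

set_option linter.unusedSimpArgs false
set_option linter.unusedVariables false

/-! ### The base case: degree six with exactly four maximal lines -/

lemma descend {X : Finset Pt} {Λ : Finset (Set Pt)} (hX : IsGC 6 X) (hΛ : ∀ L ∈ Λ, Mx 6 X L)
    (hc : Λ.card = 4) {l N : Set Pt} (hl : l ∈ Λ) (hN : Mx 2 (rem X Λ) N)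
    (hh : ∀ K ∈ Λ, K ≠ l → Hit X Λ K N) :
    IsGC 5 (rm X l) ∧ (∀ L ∈ insert N (Λ.erase l), Mx 5 (rm X l) L) ∧
    1 + (insert N (Λ.erase l)).card = 5 ∧
    rem (rm X l) (insert N (Λ.erase l)) = rm (rem X Λ) N ∧
    ∀ K ∈ Λ, K ≠ l → ∀ B, Free (rm X l) (insert N (Λ.erase l)) K B ↔ Free X Λ K B ∧ B ∉ N := by
  have hNΛ : N ∉ Λ := not_mem_of_rem hN
  refine ⟨hX.rm (hΛ l hl), ?_, ?_, ?_, ?_⟩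
  · intro L hL
    rcases Finset.mem_insert.1 hL with rfl | hL
    · have := ext_lines hN (Finset.erase_subset l Λ) (fun K hK => hh K (Finset.mem_of_mem_erase hK)
        (Finset.ne_of_mem_erase hK))
      have e : Λ \ Λ.erase l = {l} := by
        ext M; simp only [Finset.mem_sdiff, Finset.mem_erase, Finset.mem_singleton]
        constructor
        · rintro ⟨h1, h2⟩; by_contra h; exact h2 ⟨h, h1⟩
        · rintro rfl; exact ⟨hl, fun h => h.1 rfl⟩
      rw [e, rem_single, Finset.card_erase_of_mem hl, hc] at this
      exact this
    · exact (hΛ L (Finset.mem_of_mem_erase hL)).stay (hΛ l hl).1 (Finset.ne_of_mem_erase hL)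
  · rw [Finset.card_insert_of_notMem (fun h => hNΛ (Finset.mem_of_mem_erase h)),
      Finset.card_erase_of_mem hl, hc]
  · ext P
    simp only [mem_rem, mem_rm, Finset.mem_insert, Finset.mem_erase]
    constructor
    · rintro ⟨⟨h1, h2⟩, h3⟩
      refine ⟨⟨h1, fun L hL => ?_⟩, h3 N (Or.inl rfl)⟩
      by_cases h : L = l
      · rw [h]; exact h2
      · exact h3 L (Or.inr ⟨h, hL⟩)
    · rintro ⟨⟨h1, h2⟩, h3⟩
      refine ⟨⟨h1, h2 l hl⟩, ?_⟩
      rintro L (rfl | ⟨-, hL⟩)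
      · exact h3
      · exact h2 L hL
  · intro K hK hKl B
    simp only [Free, mem_rm, Finset.mem_insert, Finset.mem_erase]
    constructor
    · rintro ⟨⟨h1, h2⟩, h3, h4⟩
      refine ⟨⟨h1, h3, fun M hM hMK => ?_⟩, h4 N (Or.inl rfl) ?_⟩
      · by_cases h : M = l
        · rw [h]; exact h2
        · exact h4 M (Or.inr ⟨h, hM⟩) hMK
      · rintro rfl; exact hNΛ hK
    · rintro ⟨⟨h1, h2, h3⟩, h4⟩
      refine ⟨⟨h1, h3 l hl hKl.symm⟩, h2, ?_⟩
      rintro M (rfl | ⟨-, hM⟩) hMK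
      · exact h4
      · exact h3 M hM hMK

lemma base_four {g : ℕ} (hGM : ∀ m ≤ g, GM m) (hg : 6 ≤ g) {X : Finset Pt} {Λ : Finset (Set Pt)}
    (hX : IsGC 6 X) (hΛ : ∀ L ∈ Λ, Mx 6 X L) (hc : Λ.card = 4) (ν l : Fin 4 → Set Pt)
    (hν : ∀ i, Mx 2 (rem X Λ) (ν i)) (hνi : Function.Injective ν) (hl : ∀ i, l i ∈ Λ)
    (hli : Function.Injective l) (hall : ∀ M ∈ Λ, ∃ i, l i = M)
    (miss : ∀ i, ¬ Hit X Λ (l i) (ν i)) : False := by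
  have hR := (rem_gc hX Λ 2 hΛ (by omega)).1
  have hit : ∀ i j, i ≠ j → Hit X Λ (l i) (ν j) := by
    intro i j hij
    exact (U1 hGM hg hX hΛ (m := 2) (by omega) (by norm_num) (hl i) (hν i) (hν j)
      (fun h => hij (hνi h))).resolve_left (miss i)
  have hF : ∀ i, ∃ B, Free X Λ (l i) B ∧ ∀ j, B ∉ ν j := by
    intro i
    obtain ⟨B, hB, hBl, h⟩ := exists_off (hΛ _ (hl i))
      (Λ.erase (l i) ∪ (Finset.univ.erase i).image ν) (by
        intro L hL
        rcases Finset.mem_union.1 hL with hL | hL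
        · exact (hΛ L (Finset.mem_of_mem_erase hL)).1
        · obtain ⟨j, -, rfl⟩ := Finset.mem_image.1 hL
          exact (hν j).1) (by
        rw [Finset.mem_union, not_or]
        refine ⟨Finset.notMem_erase _ _, ?_⟩
        intro hL
        obtain ⟨j, -, hj⟩ := Finset.mem_image.1 hL
        exact not_mem_of_rem (hν j) (hj ▸ hl i)) (by
        refine (Finset.card_union_le _ _).trans ?_
        have h1 := Finset.card_image_le (s := Finset.univ.erase i) (f := ν)
        rw [Finset.card_erase_of_mem (Finset.mem_univ i), Finset.card_univ, Fintype.card_fin] at h1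
        rw [Finset.card_erase_of_mem (hl i), hc]
        omega)
    have hf : Free X Λ (l i) B := ⟨hB, hBl, fun M hM hMl =>
      h M (Finset.mem_union_left _ (Finset.mem_erase.2 ⟨hMl, hM⟩))⟩
    refine ⟨B, hf, fun j => ?_⟩
    by_cases hij : j = i
    · rw [hij]; exact fun h => miss i ⟨B, hf, h⟩
    · exact h _ (Finset.mem_union_right _ (Finset.mem_image_of_mem _
        (Finset.mem_erase.2 ⟨hij, Finset.mem_univ j⟩)))
  choose F hF1 hF2 using hF
  refine E_alg ν F (fun i => (hν i).1) (fun i => hF2 i i) ?_ ?_ ?_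
  · intro i j hij
    exact (hF1 i).ne_free (hl j) (fun h => hij (hli h)) (hF1 j)
  · intro i j hij
    obtain ⟨k, t, hik, hjk, hit', hjt, hkt⟩ : ∃ k t : Fin 4, i ≠ k ∧ j ≠ k ∧ i ≠ t ∧ j ≠ t ∧ k ≠ t := by
      clear * - hij
      revert i j; decide
    obtain ⟨d1, d2, d3, d4, d5⟩ := descend hX hΛ hc (hl t) (hν t) (by
      intro K hK hKt
      obtain ⟨s, rfl⟩ := hall K hK
      exact hit s t (fun h => hKt (by rw [h])))
    set Y := rm X (l t)
    set Λ' := insert (ν t) (Λ.erase (l t)) with hΛ'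
    have inΛ : ∀ s, s ≠ t → l s ∈ Λ' := fun s hs =>
      Finset.mem_insert_of_mem (Finset.mem_erase.2 ⟨fun h => hs (hli h), hl s⟩)
    have side : ∀ s, s ≠ t → Mx 1 (rem Y Λ') (ν s) := by
      intro s hs
      rw [d4]
      exact (hν s).stay (hν t).1 (fun h => hs (hνi h))
    have free : ∀ s, s ≠ t → Free Y Λ' (l s) (F s) := by
      intro s hs
      exact (d5 _ (hl s) (fun h => hs (hli h)) _).2 ⟨hF1 s, hF2 s t⟩
    have miss' : ∀ s, s ≠ t → ¬ Hit Y Λ' (l s) (ν s) := by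
      rintro s hs ⟨B, hB, hBν⟩
      exact miss s ⟨B, ((d5 _ (hl s) (fun h => hs (hli h)) _).1 hB).1, hBν⟩
    have hit' : ∀ s u, s ≠ t → u ≠ t → s ≠ u → Hit Y Λ' (l s) (ν u) := by
      intro s u hs hu hsu
      exact (U1 hGM (by omega) d1 d2 d3 le_rfl (inΛ s hs) (side s hs) (side u hu)
        (fun h => hsu (hνi h))).resolve_left (miss' s hs)
    obtain ⟨O, hO, hOi, hOj⟩ := G3 hR (hν i) (hν j)
    have nit : i ≠ t := by assumption
    obtain ⟨r, lr, -, r1, r2, r3⟩ := L3b d1 d2 d3 (inΛ i nit) (inΛ j hjt) (fun h => hij (hli h))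
      (side i nit) (side j hjt) (side k hkt) (fun h => hij (hνi h)) (fun h => hik (hνi h))
      (fun h => hjk (hνi h)) (hit' i k nit hkt hik) (hit' j k hjt hkt hjk) (hit' i j nit hjt hij)
      (hit' j i hjt nit hij.symm) (free i nit) (free j hjt) (hF2 i i) (hF2 i j) (hF2 i k)
      (hF2 j i) (hF2 j j) (hF2 j k) hOi hOj
    exact ⟨O, r, lr, r1, r2, r3, hOi, hOj⟩
  · intro i j k hij hik hjk O h1 h2 h3
    exact G4 (by norm_num) hR (hν i) (hν j) (hν k) (fun h => hij (hνi h)) (fun h => hik (hνi h))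
      (fun h => hjk (hνi h)) h1 h2 h3

lemma r3_step {g : ℕ} (hGM : ∀ m ≤ g, GM m) (hg : 6 ≤ g) {X : Finset Pt} {Λ : Finset (Set Pt)}
    (hX : IsGC 6 X) (hΛ : ∀ L ∈ Λ, Mx 6 X L) (hc : Λ.card = 4) {N1 N2 N3 l1 l2 l3 l4 : Set Pt}
    (m1 : Mx 2 (rem X Λ) N1) (m2 : Mx 2 (rem X Λ) N2) (m3 : Mx 2 (rem X Λ) N3)
    (h12 : N1 ≠ N2) (h13 : N1 ≠ N3) (h23 : N2 ≠ N3)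
    (hR3 : ∀ N, Mx 2 (rem X Λ) N → N = N1 ∨ N = N2 ∨ N = N3)
    (k1 : l1 ∈ Λ) (k2 : l2 ∈ Λ) (k3 : l3 ∈ Λ) (k4 : l4 ∈ Λ)
    (h14 : l1 ≠ l4) (h24 : l2 ≠ l4) (h34 : l3 ≠ l4)
    (hall : ∀ M ∈ Λ, M = l1 ∨ M = l2 ∨ M = l3 ∨ M = l4)
    (x1 : ¬ Hit X Λ l1 N1) (x2 : ¬ Hit X Λ l2 N2) (x3 : ¬ Hit X Λ l3 N3) (h4 : Hit X Λ l4 N1) :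
    Hit X Λ l4 N2 ∧ Hit X Λ l4 N3 ∧ ∃ τ Q, Mx 1 (rm (rem X Λ) N1) τ ∧ ¬ Mx 2 (rem X Λ) τ ∧
      τ ≠ N2 ∧ τ ≠ N3 ∧ Free X Λ l4 Q ∧ Q ∉ N1 ∧ Q ∉ N2 ∧ Q ∉ N3 ∧ Q ∈ τ := by
  have hR := (rem_gc hX Λ 2 hΛ (by omega)).1
  have u : ∀ {K N N'}, K ∈ Λ → Mx 2 (rem X Λ) N → Mx 2 (rem X Λ) N' → N ≠ N' →
      ¬ Hit X Λ K N → Hit X Λ K N' := fun hK hN hN' hne hh =>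
    (U1 hGM hg hX hΛ (m := 2) (by omega) (by norm_num) hK hN hN' hne).resolve_left hh
  have e12 : l2 ≠ l1 := by rintro rfl; exact x2 (u k1 m1 m2 h12 x1)
  have e13 : l3 ≠ l1 := by rintro rfl; exact x3 (u k1 m1 m3 h13 x1)
  obtain ⟨d1, d2, d3, d4, d5⟩ := descend hX hΛ hc k1 m1 (by
    intro K hK hK1
    rcases hall K hK with rfl | rfl | rfl | rfl
    · exact absurd rfl hK1
    · exact u hK m2 m1 h12.symm x2
    · exact u hK m3 m1 h13.symm x3
    · exact h4)
  have hR1 := hR.rm m1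
  set Y := rm X l1
  set Λ' := insert N1 (Λ.erase l1) with hΛ'
  have inΛ : ∀ K, K ∈ Λ → K ≠ l1 → K ∈ Λ' := fun K hK hne =>
      Finset.mem_insert_of_mem (Finset.mem_erase.2 ⟨hne, hK⟩)
  have s2 : Mx 1 (rem Y Λ') N2 := by rw [d4]; exact m2.stay m1.1 h12.symm
  have s3 : Mx 1 (rem Y Λ') N3 := by rw [d4]; exact m3.stay m1.1 h13.symm
  obtain ⟨τ, hτ, hτ2, hτ3⟩ : ∃ τ, Mx 1 (rem Y Λ') τ ∧ τ ≠ N2 ∧ τ ≠ N3 := by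
    rw [d4]
    obtain ⟨A, B, c, hAB, hAC, hBC, hA, hB, hC⟩ := k3_one hR1
    by_cases a1 : A ≠ N2 ∧ A ≠ N3
    · exact ⟨A, hA, a1⟩
    · by_cases a2 : B ≠ N2 ∧ B ≠ N3
      · exact ⟨B, hB, a2⟩
      · refine ⟨c, hC, ?_⟩
        grind
  have hτ' : Mx 1 (rm (rem X Λ) N1) τ := by rw [← d4]; exact hτ
  have hτn : ¬ Mx 2 (rem X Λ) τ := by
    intro h
    rcases hR3 τ h with h | h | h
    · exact hτ'.ne_of_rm h
    · exact hτ2 h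
    · exact hτ3 h
  have y1 : ¬ Hit Y Λ' N1 τ := by
    rintro ⟨B, hB, hBτ⟩
    apply hτn
    refine hτ'.lift (P := B) ?_ hB.2.1 hBτ
    refine mem_rem.2 ⟨(mem_rm.1 hB.1).1, ?_⟩
    intro L hL
    by_cases h : L = l1
    · rw [h]; exact (mem_rm.1 hB.1).2
    · exact hB.2.2 L (inΛ L hL h) (by rintro rfl; exact not_mem_of_rem m1 hL)
  have y2 : ¬ Hit Y Λ' l2 N2 := by
    rintro ⟨B, hB, hBN⟩
    exact x2 ⟨B, ((d5 l2 k2 e12 B).1 hB).1, hBN⟩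
  have y3 : ¬ Hit Y Λ' l3 N3 := by
    rintro ⟨B, hB, hBN⟩
    exact x3 ⟨B, ((d5 l3 k3 e13 B).1 hB).1, hBN⟩
  have i2 := inΛ l2 k2 e12
  have i3 := inΛ l3 k3 e13
  have i4 := inΛ l4 k4 h14.symm
  have i1 : N1 ∈ Λ' := Finset.mem_insert_self _ _
  have z2 : Hit Y Λ' l4 N2 := by
    by_contra h
    exact L3' hGM (by omega) d1 d2 d3 s2 s3 hτ h23 hτ2.symm hτ3.symm i2 i4 i3 i1 h24 y2 h y3 y1
  have z3 : Hit Y Λ' l4 N3 := by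
    by_contra h
    exact L3' hGM (by omega) d1 d2 d3 s3 s2 hτ h23.symm hτ3.symm hτ2.symm i3 i4 i2 i1 h34 y3 h y2 y1
  have z1 : Hit Y Λ' l4 τ := by
    by_contra h
    exact L3' hGM (by omega) d1 d2 d3 hτ s2 s3 hτ2 hτ3 h23 i1 i4 i2 i3
      (by rintro rfl; exact not_mem_of_rem m1 k4) y1 h y2 y3
  have hR' : IsGC 1 (rem Y Λ') := by rw [d4]; exact hR1
  have inR : ∀ {N P}, Mx 1 (rem Y Λ') N → τ ≠ N → P ∈ τ → P ∈ N → P ∉ l4 := by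
    intro N P hN hne h1 h2
    obtain ⟨Q, hQ, hQN, hQN'⟩ := G3 hR' hτ hN
    rw [meet_unique hτ.1 hN.1 hne h1 h2 hQN hQN']
    exact (mem_rem.1 hQ).2 l4 i4
  refine ⟨?_, ?_, ?_⟩
  · obtain ⟨B, hB, hBN⟩ := z2
    exact ⟨B, ((d5 l4 k4 h14.symm B).1 hB).1, hBN⟩
  · obtain ⟨B, hB, hBN⟩ := z3
    exact ⟨B, ((d5 l4 k4 h14.symm B).1 hB).1, hBN⟩
  · obtain ⟨Q, hQ, hQτ⟩ := z1
    obtain ⟨q1, q2⟩ := (d5 l4 k4 h14.symm Q).1 hQ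
    exact ⟨τ, Q, hτ', hτn, hτ2, hτ3, q1, q2, fun h => inR s2 hτ2 hQτ h hQ.2.1,
      fun h => inR s3 hτ3 hQτ h hQ.2.1, hQτ⟩

lemma base_three {g : ℕ} (hGM : ∀ m ≤ g, GM m) (hg : 6 ≤ g) {X : Finset Pt} {Λ : Finset (Set Pt)}
    (hX : IsGC 6 X) (hΛ : ∀ L ∈ Λ, Mx 6 X L) (hc : Λ.card = 4) {N1 N2 N3 l1 l2 l3 l4 : Set Pt}
    (m1 : Mx 2 (rem X Λ) N1) (m2 : Mx 2 (rem X Λ) N2) (m3 : Mx 2 (rem X Λ) N3)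
    (h12 : N1 ≠ N2) (h13 : N1 ≠ N3) (h23 : N2 ≠ N3)
    (hR3 : ∀ N, Mx 2 (rem X Λ) N → N = N1 ∨ N = N2 ∨ N = N3)
    (k1 : l1 ∈ Λ) (k2 : l2 ∈ Λ) (k3 : l3 ∈ Λ) (k4 : l4 ∈ Λ)
    (h14 : l1 ≠ l4) (h24 : l2 ≠ l4) (h34 : l3 ≠ l4)
    (hall : ∀ M ∈ Λ, M = l1 ∨ M = l2 ∨ M = l3 ∨ M = l4)
    (x1 : ¬ Hit X Λ l1 N1) (x2 : ¬ Hit X Λ l2 N2) (x3 : ¬ Hit X Λ l3 N3) : False := by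
  have hR := (rem_gc hX Λ 2 hΛ (by omega)).1
  have step1 := r3_step hGM hg hX hΛ hc m1 m2 m3 h12 h13 h23 hR3 k1 k2 k3 k4 h14 h24 h34 hall x1 x2 x3
  have step2 := r3_step hGM hg hX hΛ hc m2 m1 m3 h12.symm h23 h13
    (fun N hN => by have := hR3 N hN; tauto) k2 k1 k3 k4 h24 h14 h34
    (fun M hM => by have := hall M hM; tauto) x2 x1 x3
  have hh : Hit X Λ l4 N1 ∧ Hit X Λ l4 N2 := by
    rcases U1 hGM hg hX hΛ (m := 2) (by omega) (by norm_num) k4 m1 m2 h12 with h | h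
    · exact ⟨h, (step1 h).1⟩
    · exact ⟨(step2 h).1, h⟩
  obtain ⟨-, hit3, τ, Q, t1, t2, t3, t4, q1, q2, q3, q4, q5⟩ := step1 hh.1
  obtain ⟨-, -, τ', Q', t1', t2', t3', t4', q1', q2', q3', q4', q5'⟩ := step2 hh.2
  have hR1 := hR.rm m1
  have hR2 := hR.rm m2
  have hQQ : Q ≠ Q' := by
    rintro rfl
    -- the node of τ on N3
    have s2 := m2.stay m1.1 h12.symm
    have s3 := m3.stay m1.1 h13.symm
    have s1' := m1.stay m2.1 h12
    have s3' := m3.stay m2.1 h23.symm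
    obtain ⟨P, hP, hPτ, hP3⟩ := G3 hR1 t1 s3
    obtain ⟨P', hP', hPτ', hP3'⟩ := G3 hR2 t1' s3'
    have a2 : P ∉ N2 := fun h => G4 le_rfl hR1 t1 s2 s3 t3 t4 h23 hPτ h hP3
    have a1' : P' ∉ N1 := fun h => G4 le_rfl hR2 t1' s1' s3' t3' t4' h13 hPτ' h hP3'
    obtain ⟨b1, b2⟩ := mem_rm.1 hP
    obtain ⟨b1', b2'⟩ := mem_rm.1 hP'
    have PP : P = P' := by
      by_contra hne
      have h1 := (m3.stay m1.1 h13.symm).stay m2.1 h23.symm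
      have sub : {P, P'} ⊆ nd (rm (rm (rem X Λ) N1) N2) N3 := by
        intro Z hZ
        simp only [Finset.mem_insert, Finset.mem_singleton] at hZ
        rcases hZ with rfl | rfl
        · exact mem_nd.2 ⟨mem_rm.2 ⟨hP, a2⟩, hP3⟩
        · exact mem_nd.2 ⟨mem_rm.2 ⟨mem_rm.2 ⟨b1', a1'⟩, b2'⟩, hP3'⟩
      have hcard := Finset.card_le_card sub
      rw [Finset.card_pair hne] at hcard
      have := (hR1.rm s2).card_le m3.1
      omega
    subst PP
    have hQP : Q ≠ P := by
      rintro rfl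
      exact (mem_rem.1 b1).2 l4 k4 q1.2.1
    have := line_unique t1.1 t1'.1 hQP q5 hPτ q5' hPτ'
    subst this
    obtain ⟨W, hW, hWτ, hW1⟩ := G3 hR2 t1' s1'
    exact t2 (t1.lift (mem_rm.1 hW).1 hW1 hWτ)
  obtain ⟨H1, f1, g1⟩ := hh.1
  obtain ⟨H2, f2, g2⟩ := hh.2
  obtain ⟨H3, f3, g3⟩ := hit3
  have inR : ∀ {N N' P P'}, Mx 2 (rem X Λ) N → Mx 2 (rem X Λ) N' → N ≠ N' → P ∈ N → P' ∈ N' →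
      P ∈ l4 → P ≠ P' := by
    rintro N N' P P' hN hN' hne h1 h2 h3 rfl
    obtain ⟨Z, hZ, hZN, hZN'⟩ := G3 hR hN hN'
    rw [meet_unique hN.1 hN'.1 hne h1 h2 hZN hZN'] at h3
    exact (mem_rem.1 hZ).2 l4 k4 h3
  have n12 := inR m1 m2 h12 g1 g2 f1.2.1
  have n13 := inR m1 m3 h13 g1 g3 f1.2.1
  have n23 := inR m2 m3 h23 g2 g3 f2.2.1
  have o1 : H1 ≠ Q := by rintro rfl; exact q2 g1
  have o2 : H2 ≠ Q := by rintro rfl; exact q3 g2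
  have o3 : H3 ≠ Q := by rintro rfl; exact q4 g3
  have o1' : H1 ≠ Q' := by rintro rfl; exact q3' g1
  have o2' : H2 ≠ Q' := by rintro rfl; exact q2' g2
  have o3' : H3 ≠ Q' := by rintro rfl; exact q4' g3
  have hS := (rem_gc hX (Λ.erase l4) 3 (fun L hL => hΛ L (Finset.mem_of_mem_erase hL))
    (by rw [Finset.card_erase_of_mem k4]; omega)).1
  have hle := hS.card_le (hΛ l4 k4).1
  have mem : ∀ {P}, Free X Λ l4 P → P ∈ nd (rem X (Λ.erase l4)) l4 := by
    intro P hP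
    refine mem_nd.2 ⟨mem_rem.2 ⟨hP.1, fun M hM => ?_⟩, hP.2.1⟩
    exact hP.2.2 M (Finset.mem_of_mem_erase hM) (Finset.ne_of_mem_erase hM)
  have sub : ({H1, H2, H3, Q, Q'} : Finset Pt) ⊆ nd (rem X (Λ.erase l4)) l4 := by
    intro Z hZ
    simp only [Finset.mem_insert, Finset.mem_singleton] at hZ
    rcases hZ with rfl | rfl | rfl | rfl | rfl
    · exact mem f1
    · exact mem f2
    · exact mem f3
    · exact mem q1
    · exact mem q1'
  have hcard := Finset.card_le_card sub
  have : ({H1, H2, H3, Q, Q'} : Finset Pt).card = 5 := by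
    rw [Finset.card_insert_of_notMem, Finset.card_insert_of_notMem, Finset.card_insert_of_notMem,
      Finset.card_pair hQQ]
    · simp [o3, o3']
    · simp [n23, o2, o2']
    · simp [n12, n13, o1, o1']
  omega

lemma exists_miss {n m : ℕ} {X : Finset Pt} {Λ : Finset (Set Pt)}
    (hΛ : ∀ L, L ∈ Λ ↔ Mx n X L) (hm : m + Λ.card = n) {N : Set Pt} (hN : Mx m (rem X Λ) N) :
    ∃ K ∈ Λ, ¬ Hit X Λ K N := by
  by_contra hcon
  push Not at hcon
  have := ext_lines hN (Finset.Subset.refl Λ) hcon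
  rw [Finset.sdiff_self, rem_empty, hm] at this
  exact not_mem_of_rem hN ((hΛ N).2 this)

lemma inj4 {a b c d : Set Pt} (h1 : a ≠ b) (h2 : a ≠ c) (h3 : a ≠ d) (h4 : b ≠ c) (h5 : b ≠ d)
    (h6 : c ≠ d) : Function.Injective ![a, b, c, d] := by
  intro i j h
  fin_cases i <;> fin_cases j <;>
    first
    | rfl
    | exact absurd h h1
    | exact absurd h h2
    | exact absurd h h3
    | exact absurd h h4
    | exact absurd h h5
    | exact absurd h h6
    | exact absurd h h1.symm
    | exact absurd h h2.symm
    | exact absurd h h3.symm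
    | exact absurd h h4.symm
    | exact absurd h h5.symm
    | exact absurd h h6.symm

lemma base6 {g : ℕ} (hGM : ∀ m ≤ g, GM m) (hg : 6 ≤ g) {X : Finset Pt} {Λ : Finset (Set Pt)}
    (hX : IsGC 6 X) (hΛ : ∀ L, L ∈ Λ ↔ Mx 6 X L) (hc : Λ.card = 4) : False := by
  have hΛ' : ∀ L ∈ Λ, Mx 6 X L := fun L hL => (hΛ L).1 hL
  have hR := (rem_gc hX Λ 2 hΛ' (by omega)).1
  have u : ∀ {K K' N N'}, K ∈ Λ → Mx 2 (rem X Λ) N → Mx 2 (rem X Λ) N' → N ≠ N' →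
      ¬ Hit X Λ K N → ¬ Hit X Λ K' N' → K ≠ K' := by
    rintro K K' N N' hK hN hN' hne h1 h2 rfl
    rcases U1 hGM hg hX hΛ' (m := 2) (by omega) (by norm_num) hK hN hN' hne with h | h
    · exact h1 h
    · exact h2 h
  obtain ⟨N1, N2, N3, h12, h13, h23, m1, m2, m3⟩ := k3 hGM 2 (by norm_num) (by omega) _ hR
  obtain ⟨l1, k1, x1⟩ := exists_miss hΛ (m := 2) (by omega) m1
  obtain ⟨l2, k2, x2⟩ := exists_miss hΛ (m := 2) (by omega) m2
  obtain ⟨l3, k3, x3⟩ := exists_miss hΛ (m := 2) (by omega) m3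
  have e12 := u k1 m1 m2 h12 x1 x2
  have e13 := u k1 m1 m3 h13 x1 x3
  have e23 := u k2 m2 m3 h23 x2 x3
  have c3 : ({l1, l2, l3} : Finset (Set Pt)).card = 3 := by
    rw [Finset.card_eq_three]; exact ⟨l1, l2, l3, e12, e13, e23, rfl⟩
  have sub3 : ({l1, l2, l3} : Finset (Set Pt)) ⊆ Λ := by
    intro M hM
    simp only [Finset.mem_insert, Finset.mem_singleton] at hM
    rcases hM with rfl | rfl | rfl <;> assumption
  have hall : ∀ l4 ∈ Λ, l4 ∉ ({l1, l2, l3} : Finset (Set Pt)) →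
      ∀ M ∈ Λ, M = l1 ∨ M = l2 ∨ M = l3 ∨ M = l4 := by
    intro l4 h4 h4n M hM
    have : insert l4 ({l1, l2, l3} : Finset (Set Pt)) = Λ := by
      apply Finset.eq_of_subset_of_card_le
      · exact Finset.insert_subset h4 sub3
      · rw [Finset.card_insert_of_notMem h4n]; omega
    rw [← this] at hM
    simp only [Finset.mem_insert, Finset.mem_singleton] at hM
    tauto
  by_cases h4 : ∃ N4, Mx 2 (rem X Λ) N4 ∧ N4 ≠ N1 ∧ N4 ≠ N2 ∧ N4 ≠ N3
  · obtain ⟨N4, m4, h41, h42, h43⟩ := h4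
    obtain ⟨l4, k4, x4⟩ := exists_miss hΛ (m := 2) (by omega) m4
    have e14 := u k1 m1 m4 h41.symm x1 x4
    have e24 := u k2 m2 m4 h42.symm x2 x4
    have e34 := u k3 m3 m4 h43.symm x3 x4
    have hall4 := hall l4 k4 (by simp [e14.symm, e24.symm, e34.symm])
    refine base_four hGM hg hX hΛ' hc ![N1, N2, N3, N4] ![l1, l2, l3, l4] ?_ ?_ ?_ ?_ ?_ ?_
    · intro i; fin_cases i <;> assumption
    · exact inj4 h12 h13 h41.symm h23 h42.symm h43.symm
    · intro i; fin_cases i <;> assumption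
    · exact inj4 e12 e13 e14 e23 e24 e34
    · intro M hM
      rcases hall4 M hM with rfl | rfl | rfl | rfl
      · exact ⟨0, rfl⟩
      · exact ⟨1, rfl⟩
      · exact ⟨2, rfl⟩
      · exact ⟨3, rfl⟩
    · intro i; fin_cases i <;> assumption
  · push Not at h4
    obtain ⟨l4, hl4⟩ : ∃ l4, l4 ∈ Λ \ {l1, l2, l3} := by
      apply Finset.card_pos.1
      rw [Finset.card_sdiff_of_subset sub3]; omega
    obtain ⟨k4, hn4⟩ := Finset.mem_sdiff.1 hl4
    have hall4 := hall l4 k4 hn4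
    simp only [Finset.mem_insert, Finset.mem_singleton, not_or] at hn4
    refine base_three hGM hg hX hΛ' hc m1 m2 m3 h12 h13 h23 ?_ k1 k2 k3 k4 (Ne.symm hn4.1)
      (Ne.symm hn4.2.1) (Ne.symm hn4.2.2) hall4 x1 x2 x3
    intro N hN
    by_contra hcon
    push Not at hcon
    exact hcon.2.2 (h4 N hN hcon.1 hcon.2.1)

open MvPolynomial
open scoped Classical
set_option linter.unusedSimpArgs false
set_option linter.unusedVariables false

lemma cl_step {g : ℕ} (hGM : ∀ m ≤ g, GM m) {n : ℕ} (hn : 1 ≤ n) (hng : n + 1 ≤ g)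
    {X : Finset Pt} (hX : IsGC (n + 1) X) {Λ : Finset (Set Pt)} (hΛ : ∀ L, L ∈ Λ ↔ Mx (n + 1) X L)
    (hs : Λ.card + 1 ≤ n) {l : Set Pt} (hl : l ∈ Λ) {T : Finset (Set Pt)}
    (hT : ∀ L ∈ T, Mx n (rm X l) L) (hc : 1 + T.card = n) :
    Λ.card + 1 = n ∧ ∃ N, N ∉ Λ ∧ Mx n (rm X l) N := by
  have h1 : (T \ Λ).card ≤ 1 := by
    rw [Finset.card_le_one]
    intro a ha b hb
    by_contra hne
    obtain ⟨a1, a2⟩ := Finset.mem_sdiff.1 ha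
    obtain ⟨b1, b2⟩ := Finset.mem_sdiff.1 hb
    rcases key hGM hn (by omega) hX ((hΛ l).1 hl) (hT a a1) (hT b b1) hne with h | h
    · exact a2 ((hΛ a).2 h)
    · exact b2 ((hΛ b).2 h)
  have h2 : (T ∩ Λ).card ≤ Λ.card - 1 := by
    rw [← Finset.card_erase_of_mem hl]
    apply Finset.card_le_card
    intro a ha
    obtain ⟨a1, a2⟩ := Finset.mem_inter.1 ha
    exact Finset.mem_erase.2 ⟨(hT a a1).ne_of_rm, a2⟩
  have h3 := Finset.card_sdiff_add_card_inter T Λ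
  have h4 : 0 < Λ.card := Finset.card_pos.2 ⟨l, hl⟩
  refine ⟨by omega, ?_⟩
  obtain ⟨N, hN⟩ := Finset.card_pos.1 (by omega : 0 < (T \ Λ).card)
  obtain ⟨a1, a2⟩ := Finset.mem_sdiff.1 hN
  exact ⟨N, a2, hT N a1⟩

lemma cl {g : ℕ} (hGM : ∀ m ≤ g, GM m) : ∀ n, 1 ≤ n → n ≤ g → ∀ X, IsGC n X →
    ∀ T : Finset (Set Pt), (∀ L ∈ T, Mx n X L) → 4 ≤ T.card →
    ∃ Λ : Finset (Set Pt), (∀ L ∈ Λ, Mx n X L) ∧ 1 + Λ.card = n := by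
  intro n hn
  induction n, hn using Nat.le_induction with
  | base => intro _ X _ T _ _; exact ⟨∅, by simp, by simp⟩
  | succ n hn ih =>
    intro hng X hX T hT hT4
    obtain ⟨Λ, hΛ⟩ := exists_maxlines (by omega) hX
    have hΛ' : ∀ L ∈ Λ, Mx (n + 1) X L := fun L h => (hΛ L).1 h
    have hs4 : 4 ≤ Λ.card := hT4.trans (Finset.card_le_card (fun L h => (hΛ L).2 (hT L h)))
    by_cases hs : n ≤ Λ.card
    · obtain ⟨S, hS, hc⟩ := Finset.exists_subset_card_eq hs
      exact ⟨S, fun L h => hΛ' L (hS h), by omega⟩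
    exfalso
    have stay : ∀ l ∈ Λ, ∀ L ∈ Λ.erase l, Mx n (rm X l) L := by
      intro l hl L hL
      exact Mx.stay (hΛ' l hl).1 (hΛ' L (Finset.mem_of_mem_erase hL)) (Finset.ne_of_mem_erase hL)
    have st : ∀ l ∈ Λ, ∀ T : Finset (Set Pt), (∀ L ∈ T, Mx n (rm X l) L) → 4 ≤ T.card →
        Λ.card + 1 = n ∧ ∃ N, N ∉ Λ ∧ Mx n (rm X l) N := by
      intro l hl T hT hc
      obtain ⟨T', hT', hc'⟩ := ih (by omega) _ (hX.rm (hΛ' l hl)) T hT hc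
      exact cl_step hGM hn hng hX hΛ (by omega) hl hT' hc'
    rcases Nat.lt_or_ge 4 Λ.card with h5 | h5
    · have h : ∀ l ∈ Λ, ∃ N, (N ∉ Λ ∧ Mx n (rm X l) N) ∧ Λ.card + 1 = n := by
        intro l hl
        obtain ⟨a, b, c⟩ := st l hl _ (stay l hl) (by rw [Finset.card_erase_of_mem hl]; omega)
        exact ⟨b, c, a⟩
      choose! ν h1 h2 using h
      obtain ⟨l0, hl0⟩ := Finset.card_pos.1 (by omega : 0 < Λ.card)
      have hcn := h2 l0 hl0
      have hR := (rem_gc hX Λ 2 hΛ' (by omega)).1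
      have hm : ∀ L ∈ Λ.image ν, Mx 2 (rem X Λ) L := by
        intro L hL
        obtain ⟨l, hl, rfl⟩ := Finset.mem_image.1 hL
        have := (rem_gc (hX.rm (hΛ' l hl)) (Λ.erase l) 2 (stay l hl)
          (by rw [Finset.card_erase_of_mem hl]; omega)).2 (ν l) (h1 l hl).2
          (fun h => (h1 l hl).1 (Finset.mem_of_mem_erase h))
        have e : rem (rm X l) (Λ.erase l) = rem X Λ := by
          ext P
          simp only [mem_rem, mem_rm, Finset.mem_erase]
          constructor
          · rintro ⟨⟨a, b⟩, c⟩
            refine ⟨a, fun M hM => ?_⟩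
            by_cases hMl : M = l
            · rw [hMl]; exact b
            · exact c M ⟨hMl, hM⟩
          · rintro ⟨a, b⟩
            exact ⟨⟨a, b l hl⟩, fun M hM => b M hM.2⟩
        rwa [e] at this
      have hcard := card_maxlines (by norm_num) hR _ hm
      rw [Finset.card_image_of_injOn] at hcard
      · omega
      · intro l hl l' hl' he
        by_contra hne
        have hl : l ∈ Λ := hl
        have hl' : l' ∈ Λ := hl'
        obtain ⟨P, p1, p2, p3⟩ := G3 (hX.rm (hΛ' l hl)) (h1 l hl).2
          (stay l hl l' (Finset.mem_erase.2 ⟨fun h => hne h.symm, hl'⟩))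
        apply (h1 l' hl').1
        exact (hΛ _).2 ((h1 l' hl').2.lift (mem_rm.1 p1).1 p3 (he ▸ p2))
    · have hc4 : Λ.card = 4 := by omega
      obtain ⟨m, hm⟩ : ∃ m, m + Λ.card = n + 1 := ⟨n + 1 - 4, by omega⟩
      have hR := (rem_gc hX Λ m hΛ' hm).1
      have fin : ∀ l ∈ Λ, ∀ N, Mx m (rem X Λ) N → (∀ K ∈ Λ, K ≠ l → Hit X Λ K N) → False := by
        intro l hl N hN hh
        have hNΛ := not_mem_of_rem hN
        have := ext_lines hN (Finset.erase_subset l Λ)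
          (fun K hK => hh K (Finset.mem_of_mem_erase hK) (Finset.ne_of_mem_erase hK))
        have e : Λ \ Λ.erase l = {l} := by
          ext M
          simp only [Finset.mem_sdiff, Finset.mem_erase, Finset.mem_singleton]
          constructor
          · rintro ⟨a, b⟩; by_contra h; exact b ⟨h, a⟩
          · rintro rfl; exact ⟨hl, fun h => h.1 rfl⟩
        rw [e, rem_single, Finset.card_erase_of_mem hl, show m + (Λ.card - 1) = n by omega] at this
        obtain ⟨hc, -⟩ := st l hl (insert N (Λ.erase l)) (by
          intro L hL
          rcases Finset.mem_insert.1 hL with rfl | hL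
          · exact this
          · exact stay l hl L hL) (by
          rw [Finset.card_insert_of_notMem (fun h => hNΛ (Finset.mem_of_mem_erase h)),
            Finset.card_erase_of_mem hl]; omega)
        have hn5 : n = 5 := by omega
        subst hn5
        exact base6 hGM hng hX hΛ hc4
      have u : ∀ {K N N'}, K ∈ Λ → Mx m (rem X Λ) N → Mx m (rem X Λ) N' → N ≠ N' →
          ¬ Hit X Λ K N → Hit X Λ K N' := by
        intro K N N' hK hN hN' hne h1
        exact (U1 hGM hng hX hΛ' hm (by omega) hK hN hN' hne).resolve_left h1
      obtain ⟨N1, N2, N3, h12, h13, h23, m1, m2, m3⟩ := k3 hGM m (by omega) (by omega) _ hR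
      obtain ⟨l1, k1, x1⟩ := exists_miss hΛ hm m1
      obtain ⟨l2, k2, x2⟩ := exists_miss hΛ hm m2
      obtain ⟨l3, k3, x3⟩ := exists_miss hΛ hm m3
      have e12 : l1 ≠ l2 := by rintro rfl; exact x2 (u k1 m1 m2 h12 x1)
      have e13 : l1 ≠ l3 := by rintro rfl; exact x3 (u k1 m1 m3 h13 x1)
      have e23 : l2 ≠ l3 := by rintro rfl; exact x3 (u k2 m2 m3 h23 x2)
      have c3 : ({l1, l2, l3} : Finset (Set Pt)).card = 3 := by
        rw [Finset.card_eq_three]; exact ⟨l1, l2, l3, e12, e13, e23, rfl⟩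
      have sub3 : ({l1, l2, l3} : Finset (Set Pt)) ⊆ Λ := by
        intro M hM
        simp only [Finset.mem_insert, Finset.mem_singleton] at hM
        rcases hM with rfl | rfl | rfl <;> assumption
      have c1 : (Λ \ {l1, l2, l3}).card = 1 := by
        rw [Finset.card_sdiff_of_subset sub3]; omega
      obtain ⟨l4, hl4⟩ := Finset.card_eq_one.1 c1
      have k4 : l4 ∈ Λ := by
        have : l4 ∈ Λ \ {l1, l2, l3} := by rw [hl4]; simp
        exact (Finset.mem_sdiff.1 this).1
      have hall : ∀ M ∈ Λ, M = l1 ∨ M = l2 ∨ M = l3 ∨ M = l4 := by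
        intro M hM
        by_cases h : M ∈ ({l1, l2, l3} : Finset (Set Pt))
        · simp only [Finset.mem_insert, Finset.mem_singleton] at h
          tauto
        · have : M ∈ Λ \ {l1, l2, l3} := Finset.mem_sdiff.2 ⟨hM, h⟩
          rw [hl4, Finset.mem_singleton] at this
          tauto
      rcases U1 hGM hng hX hΛ' hm (by omega) k4 m1 m2 h12 with h | h
      · refine fin l1 k1 N1 m1 (fun K hK hne => ?_)
        rcases hall K hK with rfl | rfl | rfl | rfl
        · exact absurd rfl hne
        · exact u k2 m2 m1 h12.symm x2
        · exact u k3 m3 m1 h13.symm x3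
        · exact h
      · refine fin l2 k2 N2 m2 (fun K hK hne => ?_)
        rcases hall K hK with rfl | rfl | rfl | rfl
        · exact u k1 m1 m2 h12 x1
        · exact absurd rfl hne
        · exact u k3 m3 m2 h23.symm x3
        · exact h

open MvPolynomial
open scoped Classical
set_option linter.unusedSimpArgs false
set_option linter.unusedVariables false

section final
variable {g n : ℕ} {X : Finset Pt} {Λ : Finset (Set Pt)}

lemma used_of_mem (hX : IsGC n X) (hΛ : ∀ L ∈ Λ, Mx n X L) (hm : 1 + Λ.card = n)
    {L : Set Pt} (hL : L ∈ Λ) : Used n X L := by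
  have hR := (rem_gc hX Λ 1 hΛ hm).1
  obtain ⟨N, _, _, _, _, _, hN, _⟩ := k3_one hR
  obtain ⟨A, hA, -⟩ := hN.nonempty
  obtain ⟨hAX, hA⟩ := mem_rem.1 hA
  obtain ⟨F, hF⟩ := hX.cover hAX
  exact (hF.2.1 L (hF.mem (hΛ L hL) (hA L hL))).2.2

lemma used_side (hX : IsGC n X) (hΛ : ∀ L ∈ Λ, Mx n X L) (hm : 1 + Λ.card = n)
    {N : Set Pt} (hN : Mx 1 (rem X Λ) N) : Used n X N := by
  have hR := (rem_gc hX Λ 1 hΛ hm).1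
  have hc : (rem X Λ).card = 3 := by rw [hR.1.1]; rfl
  have h2 := hN.card hR
  have h3 := card_nd_add_rm (rem X Λ) N
  obtain ⟨A, hA⟩ := Finset.card_pos.1 (by omega : 0 < (rm (rem X Λ) N).card)
  obtain ⟨hAR, hAN⟩ := mem_rm.1 hA
  obtain ⟨hAX, hAΛ⟩ := mem_rem.1 hAR
  obtain ⟨F, hF⟩ := hX.cover hAX
  have hsub : Λ ⊆ F := fun L hL => hF.mem (hΛ L hL) (hAΛ L hL)
  have h1 : (F \ Λ).card ≤ 1 := by
    rw [Finset.card_sdiff_of_subset hsub]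
    have := hF.1
    omega
  obtain ⟨B, C, hBC, he⟩ := Finset.card_eq_two.1 h2
  have hB : B ∈ nd (rem X Λ) N := by rw [he]; simp
  have hC : C ∈ nd (rem X Λ) N := by rw [he]; simp
  have cov : ∀ B ∈ nd (rem X Λ) N, ∃ K ∈ F \ Λ, B ∈ K := by
    intro B hB
    obtain ⟨b1, b2⟩ := mem_nd.1 hB
    obtain ⟨b3, b4⟩ := mem_rem.1 b1
    obtain ⟨K, hK, hBK⟩ := hF.2.2 B b3 (by rintro rfl; exact hAN b2)
    exact ⟨K, Finset.mem_sdiff.2 ⟨hK, fun h => b4 K h hBK⟩, hBK⟩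
  obtain ⟨K, hK, hBK⟩ := cov B hB
  obtain ⟨K', hK', hCK⟩ := cov C hC
  obtain rfl := Finset.card_le_one.1 h1 K hK K' hK'
  have hKF := hF.2.1 K (Finset.mem_sdiff.1 hK).1
  have : K = N := line_unique hKF.1 hN.1 hBC hBK hCK (mem_nd.1 hB).2 (mem_nd.1 hC).2
  rw [← this]
  exact hKF.2.2

lemma off_unique (hGM : ∀ m ≤ g, GM m) (hng : n ≤ g) (hX : IsGC n X) (hΛ : ∀ L ∈ Λ, Mx n X L)
    (hm : 1 + Λ.card = n) {l : Set Pt} (hl : IsLine l) (hlu : ¬ Used n X l) {N1 N2 N3 : Set Pt}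
    (h12 : N1 ≠ N2) (h13 : N1 ≠ N3) (h23 : N2 ≠ N3) (m1 : Mx 1 (rem X Λ) N1)
    (m2 : Mx 1 (rem X Λ) N2) (m3 : Mx 1 (rem X Λ) N3) {K K' : Set Pt} (hK : K ∈ Λ) (hK' : K' ∈ Λ)
    {B B' : Pt} (hB : Free X Λ K B) (hB' : Free X Λ K' B') (hBl : B ∈ l) (hBl' : B' ∈ l)
    (b1 : B ∉ N1) (b2 : B ∉ N2) (b3 : B ∉ N3) (b1' : B' ∉ N1) (b2' : B' ∉ N2) (b3' : B' ∉ N3) :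
    B = B' := by
  by_contra hBB
  have hR := (rem_gc hX Λ 1 hΛ hm).1
  have hne : K ≠ K' := by
    rintro rfl
    have : K = l := line_unique (hΛ K hK).1 hl hBB hB.2.1 hB'.2.1 hBl hBl'
    exact hlu (this ▸ used_of_mem hX hΛ hm hK)
  have fin : ∀ r, IsLine r → Used n X r → B ∈ r → B' ∈ r → False := by
    intro r r1 r2 r3 r4
    exact hlu (line_unique r1 hl hBB r3 r4 hBl hBl' ▸ r2)
  have hA : ∀ N N', Mx 1 (rem X Λ) N → Mx 1 (rem X Λ) N' → N ≠ N' → B ∉ N → B' ∉ N → B ∉ N' →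
      B' ∉ N' → Hit X Λ K N → Hit X Λ K' N → Hit X Λ K N' → Hit X Λ K' N' → False := by
    intro N N' a1 a2 a3 a4 a5 a6 a7 a8 a9 a10 a11
    obtain ⟨r, r1, r2, r3, r4⟩ := L3a hX hΛ hm hK hK' hne a1 a2 a3 a8 a9 a10 a11 hB hB' a4 a6 a5 a7
    exact fin r r1 r2 r3 r4
  have hBb : ∀ N N' M, Mx 1 (rem X Λ) N → Mx 1 (rem X Λ) N' → Mx 1 (rem X Λ) M → N ≠ N' →
      N ≠ M → N' ≠ M → B ∉ N → B' ∉ N → B ∉ N' → B' ∉ N' → B ∉ M → B' ∉ M →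
      Hit X Λ K M → Hit X Λ K' M → Hit X Λ K N' → Hit X Λ K' N → False := by
    intro N N' M a1 a2 a3 c1 c2 c3 d1 d1' d2 d2' d3 d3' e1 e2 e3 e4
    obtain ⟨O, -, hO, hO'⟩ := G3 hR a1 a2
    obtain ⟨r, r1, r2, r3, r4, -⟩ := L3b hX hΛ hm hK hK' hne a1 a2 a3 c1 c2 c3 e1 e2 e3 e4 hB hB'
      d1 d2 d3 d1' d2' d3' hO hO'
    exact fin r r1 r2 r3 r4
  have u : ∀ K ∈ Λ, ∀ N N', Mx 1 (rem X Λ) N → Mx 1 (rem X Λ) N' → N ≠ N' →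
      Hit X Λ K N ∨ Hit X Λ K N' := by
    intro K hK N N' a b c
    exact U1 hGM hng hX hΛ hm le_rfl hK a b c
  have u1 := u K hK _ _ m1 m2 h12
  have u2 := u K hK _ _ m1 m3 h13
  have u3 := u K hK _ _ m2 m3 h23
  have v1 := u K' hK' _ _ m1 m2 h12
  have v2 := u K' hK' _ _ m1 m3 h13
  have v3 := u K' hK' _ _ m2 m3 h23
  have w1 := hA _ _ m1 m2 h12 b1 b1' b2 b2'
  have w2 := hA _ _ m1 m3 h13 b1 b1' b3 b3'
  have w3 := hA _ _ m2 m3 h23 b2 b2' b3 b3'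
  have z1 := hBb _ _ _ m1 m2 m3 h12 h13 h23 b1 b1' b2 b2' b3 b3'
  have z2 := hBb _ _ _ m2 m1 m3 h12.symm h23 h13 b2 b2' b1 b1' b3 b3'
  have z3 := hBb _ _ _ m1 m3 m2 h13 h12 h23.symm b1 b1' b3 b3' b2 b2'
  have z4 := hBb _ _ _ m3 m1 m2 h13.symm h23.symm h12 b3 b3' b1 b1' b2 b2'
  have z5 := hBb _ _ _ m2 m3 m1 h23 h12.symm h13.symm b2 b2' b3 b3' b1 b1'
  have z6 := hBb _ _ _ m3 m2 m1 h23.symm h13.symm h12.symm b3 b3' b2 b2' b1 b1'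
  clear hA hBb fin u
  generalize Hit X Λ K N1 = p1 at *
  generalize Hit X Λ K N2 = p2 at *
  generalize Hit X Λ K N3 = p3 at *
  generalize Hit X Λ K' N1 = q1 at *
  generalize Hit X Λ K' N2 = q2 at *
  generalize Hit X Λ K' N3 = q3 at *
  clear b1 b2 b3 b1' b2' b3' m1 m2 m3 h12 h13 h23
  by_cases p1 <;> by_cases p2 <;> by_cases p3 <;> by_cases q1 <;> by_cases q2 <;> by_cases q3 <;>
    simp_all only [true_or, or_true, or_false, false_or, forall_const, not_true_eq_false,
      not_false_eq_true, false_imp_iff, imp_false]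

lemma final_bound (hGM : ∀ m ≤ g, GM m) (hng : n ≤ g) (hX : IsGC n X) (hΛ : ∀ L ∈ Λ, Mx n X L)
    (hm : 1 + Λ.card = n) {l : Set Pt} (hl : IsLine l) (hlu : ¬ Used n X l) :
    2 * (nd X l).card ≤ n + 3 := by
  have hR := (rem_gc hX Λ 1 hΛ hm).1
  have hRc : (rem X Λ).card = 3 := by rw [hR.1.1]; rfl
  obtain ⟨N1, N2, N3, h12, h13, h23, m1, m2, m3⟩ := k3_one hR
  have hlΛ : l ∉ Λ := fun h => hlu (used_of_mem hX hΛ hm h)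
  have hlN : ∀ N, Mx 1 (rem X Λ) N → N ≠ l := by
    rintro N hN rfl; exact hlu (used_side hX hΛ hm hN)
  set S := nd X l with hS
  let w : Pt → ℕ := fun B => (Λ.filter (fun L => B ∈ L)).card
  let S0 := S.filter (fun B => w B = 0)
  let S1 := S.filter (fun B => w B = 1)
  have mS : ∀ {B}, B ∈ S → B ∈ X ∧ B ∈ l := fun h => mem_nd.1 h
  have hw2 : ∀ B, w B ≤ 2 := by
    intro B
    by_contra hcon
    push Not at hcon
    obtain ⟨a, b, c, ha, hb, hc, hab, hac, hbc⟩ := Finset.two_lt_card_iff.1 hcon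
    obtain ⟨a1, a2⟩ := Finset.mem_filter.1 ha
    obtain ⟨b1, b2⟩ := Finset.mem_filter.1 hb
    obtain ⟨c1, c2⟩ := Finset.mem_filter.1 hc
    exact G4 (by omega) hX (hΛ a a1) (hΛ b b1) (hΛ c c1) hab hac hbc a2 b2 c2
  have hsum : ∑ B ∈ S, w B ≤ Λ.card := by
    have h := Finset.sum_card_bipartiteAbove_eq_sum_card_bipartiteBelow (s := S) (t := Λ)
      (fun (B : Pt) (L : Set Pt) => B ∈ L)
    have h' : ∑ B ∈ S, w B = ∑ L ∈ Λ, (S.filter (fun B => B ∈ L)).card := h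
    rw [h', Finset.card_eq_sum_ones]
    apply Finset.sum_le_sum
    intro L hL
    refine common_le_one hl (hΛ L hL).1 (by rintro rfl; exact hlΛ hL) _ (fun P hP => ?_)
    obtain ⟨p1, p2⟩ := Finset.mem_filter.1 hP
    exact ⟨(mS p1).2, p2⟩
  have hcount : 2 * S.card ≤ ∑ B ∈ S, w B + 2 * S0.card + S1.card := by
    have e0 : S0.card = ∑ B ∈ S, if w B = 0 then 1 else 0 := Finset.card_filter _ _
    have e1 : S1.card = ∑ B ∈ S, if w B = 1 then 1 else 0 := Finset.card_filter _ _
    rw [e0, e1, Finset.mul_sum, ← Finset.sum_add_distrib, ← Finset.sum_add_distrib, mul_comm,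
      ← smul_eq_mul, ← Finset.sum_const]
    apply Finset.sum_le_sum
    intro B _
    split_ifs <;> omega
  have mS0 : ∀ {B}, B ∈ S0 → B ∈ rem X Λ ∧ B ∈ l := by
    intro B hB
    obtain ⟨b1, b2⟩ := Finset.mem_filter.1 hB
    refine ⟨mem_rem.2 ⟨(mS b1).1, fun M hM hBM => ?_⟩, (mS b1).2⟩
    have := Finset.card_eq_zero.1 b2
    have h : M ∈ Λ.filter (fun L => B ∈ L) := Finset.mem_filter.2 ⟨hM, hBM⟩
    rw [this] at h
    simp at h
  have mS1 : ∀ {B}, B ∈ S1 → B ∈ l ∧ ∃ K ∈ Λ, Free X Λ K B := by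
    intro B hB
    obtain ⟨b1, b2⟩ := Finset.mem_filter.1 hB
    obtain ⟨K, hK⟩ := Finset.card_eq_one.1 b2
    have h : K ∈ Λ.filter (fun L => B ∈ L) := by rw [hK]; simp
    obtain ⟨k1, k2⟩ := Finset.mem_filter.1 h
    refine ⟨(mS b1).2, K, k1, (mS b1).1, k2, fun M hM hne hBM => hne ?_⟩
    have h : M ∈ Λ.filter (fun L => B ∈ L) := Finset.mem_filter.2 ⟨hM, hBM⟩
    rw [hK] at h
    exact Finset.mem_singleton.1 h
  have hS0 : S0.card ≤ 1 := by
    by_contra hcon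
    have : Mx 1 (rem X Λ) l := by
      refine ⟨hl, ?_⟩
      have : S0.card ≤ (nd (rem X Λ) l).card := Finset.card_le_card fun B hB => mem_nd.2 (mS0 hB)
      omega
    exact hlN l this rfl
  have hdis : Disjoint S0 S1 := by
    rw [Finset.disjoint_left]
    intro B h0 h1
    have a := (Finset.mem_filter.1 h0).2
    have b := (Finset.mem_filter.1 h1).2
    omega
  have hside : ∀ N, Mx 1 (rem X Λ) N →
      (S0.filter (fun B => B ∈ N)).card + (S1.filter (fun B => B ∈ N)).card ≤ 1 := by
    intro N hN
    rw [← Finset.card_union_of_disjoint (Finset.disjoint_filter_filter hdis)]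
    refine common_le_one hl hN.1 (hlN N hN).symm _ (fun P hP => ?_)
    rcases Finset.mem_union.1 hP with h | h
    · obtain ⟨a, b⟩ := Finset.mem_filter.1 h
      exact ⟨(mS0 a).2, b⟩
    · obtain ⟨a, b⟩ := Finset.mem_filter.1 h
      exact ⟨(mS1 a).1, b⟩
  have s1 := hside N1 m1
  have s2 := hside N2 m2
  have s3 := hside N3 m3
  let T := S1.filter (fun B => B ∉ N1 ∧ B ∉ N2 ∧ B ∉ N3)
  have hT : T.card ≤ 1 := by
    rw [Finset.card_le_one]
    intro B hB B' hB'
    obtain ⟨a, b1, b2, b3⟩ := Finset.mem_filter.1 hB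
    obtain ⟨a', b1', b2', b3'⟩ := Finset.mem_filter.1 hB'
    obtain ⟨hBl, K, hK, hf⟩ := mS1 a
    obtain ⟨hBl', K', hK', hf'⟩ := mS1 a'
    exact off_unique hGM hng hX hΛ hm hl hlu h12 h13 h23 m1 m2 m3 hK hK' hf hf' hBl hBl'
      b1 b2 b3 b1' b2' b3'
  have hS1 : S1.card ≤ (S1.filter (fun B => B ∈ N1)).card + (S1.filter (fun B => B ∈ N2)).card +
      (S1.filter (fun B => B ∈ N3)).card + T.card := by
    have hsub : S1 ⊆ ((S1.filter (fun B => B ∈ N1) ∪ S1.filter (fun B => B ∈ N2)) ∪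
        S1.filter (fun B => B ∈ N3)) ∪ T := by
      intro B hB
      simp only [Finset.mem_union, T, Finset.mem_filter]
      tauto
    have q1 := Finset.card_le_card hsub
    have q2 := Finset.card_union_le ((S1.filter (fun B => B ∈ N1) ∪ S1.filter (fun B => B ∈ N2)) ∪
        S1.filter (fun B => B ∈ N3)) T
    have q3 := Finset.card_union_le (S1.filter (fun B => B ∈ N1) ∪ S1.filter (fun B => B ∈ N2))
        (S1.filter (fun B => B ∈ N3))
    have q4 := Finset.card_union_le (S1.filter (fun B => B ∈ N1)) (S1.filter (fun B => B ∈ N2))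
    omega
  have two : ∀ O ∈ rem X Λ, ∀ N N', Mx 1 (rem X Λ) N → Mx 1 (rem X Λ) N' → N ≠ N' →
      O ∈ N ∨ O ∈ N' := by
    intro O hO N N' hN hN' hne
    by_contra hcon
    push Not at hcon
    have e : ∀ N, Mx 1 (rem X Λ) N → O ∉ N → nd (rem X Λ) N = (rem X Λ).erase O := by
      intro N hN hON
      apply Finset.eq_of_subset_of_card_le
      · intro P hP
        obtain ⟨a, b⟩ := mem_nd.1 hP
        exact Finset.mem_erase.2 ⟨by rintro rfl; exact hON b, a⟩
      · rw [Finset.card_erase_of_mem hO, hRc]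
        exact hN.2
    have e1 := e N hN hcon.1
    have e2 := e N' hN' hcon.2
    have := common_le_one hN.1 hN'.1 hne (nd (rem X Λ) N) (fun P hP => by
      refine ⟨(mem_nd.1 hP).2, ?_⟩
      rw [e1, ← e2] at hP
      exact (mem_nd.1 hP).2)
    have := hN.2
    omega
  have h0 : 2 * S0.card ≤ (S0.filter (fun B => B ∈ N1)).card + (S0.filter (fun B => B ∈ N2)).card +
      (S0.filter (fun B => B ∈ N3)).card := by
    have cf : ∀ N : Set Pt, (S0.filter (fun B => B ∈ N)).card = ∑ B ∈ S0, if B ∈ N then 1 else 0 :=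
      fun N => Finset.card_filter _ _
    rw [cf N1, cf N2, cf N3, ← Finset.sum_add_distrib,
      ← Finset.sum_add_distrib, mul_comm, ← smul_eq_mul, ← Finset.sum_const]
    apply Finset.sum_le_sum
    intro O hO
    have t1 := two O (mS0 hO).1 _ _ m1 m2 h12
    have t2 := two O (mS0 hO).1 _ _ m1 m3 h13
    have t3 := two O (mS0 hO).1 _ _ m2 m3 h23
    split_ifs <;> first | omega | tauto
  omega

end final

theorem stmt_1 (n k : ℕ) (hGM : ∀ m ≤ n, GM m)
    (X : Finset (ℝ × ℝ)) (hX : IsGC n X)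
    (ℓ : Poly2) (hk2 : 2 ≤ k) (hkn : k ≤ n + 1) (hℓ : IsKNodeLine X ℓ k)
    (hσ : (3 : ℤ) ≤ (2 * k : ℤ) - n - 1) (hμ : 3 < mu n X) :
    usesSet n X ℓ ≠ ∅ := by
  have hn : 1 ≤ n := by omega
  obtain ⟨T, hT⟩ := exists_maxlines hn hX
  have hT4 : 4 ≤ T.card := by
    have hsub : {L : Set (ℝ × ℝ) | ∃ ℓ : Poly2, IsMaximalLine n X ℓ ∧ L = zeroSet ℓ} ⊆
        (T : Set (Set Pt)) := by
      rintro L ⟨l, ⟨h1, h2⟩, rfl⟩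
      refine (hT _).2 ⟨isLine_zeroSet h1, ?_⟩
      rw [← h2]
      apply le_of_eq
      congr 1
    have h1 := Set.ncard_le_ncard hsub T.finite_toSet
    rw [Set.ncard_coe_finset] at h1
    exact lt_of_lt_of_le hμ h1
  obtain ⟨Λ, hΛ, hm⟩ := cl hGM n hn le_rfl X hX T (fun L h => (hT L).1 h) hT4
  have hk : (nd X (zeroSet ℓ)).card = k := by
    rw [← hℓ.2]
    congr 1
  have hU : Used n X (zeroSet ℓ) := by
    by_contra h
    have := final_bound hGM le_rfl hX hΛ hm (isLine_zeroSet hℓ.1) h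
    omega
  obtain ⟨A, hA, p, hp, q, hq, hz, hd⟩ := hU
  obtain ⟨c, hc, he⟩ := eq_of_zeroSet_eq q ℓ hq hℓ.1 hz
  apply Finset.ne_empty_of_mem (a := A)
  refine Finset.mem_filter.2 ⟨hA, p, hp, ?_⟩
  rw [he]
  have hu : IsUnit (C c : Poly2) := (IsUnit.mk0 c hc).map C
  exact (hu.mul_left_dvd).2 hd
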